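/- arXiv:1606.05479 — 3 statements merged into one kernel-verified Lean document; each statement's English description precedes it below -/
import Mathlib

section
/- Let 1 < p ≤ q < ∞, let 0 ≤ θ < π/2, let α < p − 1, and let μ be a positive Borel measure on ℂ₊ supported in the sector S(θ). Then the Laplace–Carleson embedding 𝔏 : L^p_{t^α}(0,∞) → L^q(ℂ₊, μ) is well-defined and bounded if and only if there exists a constant C > 0 such that for every r > 0, μ(Δ_r) ≤ C r^{(q/p′)(1 − α/(p−1))}. -/
open MeasureTheory Set Complex Filter ENNReal

/-- The Laplace transform of `f : (0,∞) → ℂ` at `z`. -/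
noncomputable def laplaceT (f : ℝ → ℂ) (z : ℂ) : ℂ :=
  ∫ t in Set.Ioi (0:ℝ), f t * Complex.exp (-(t : ℂ) * z)

/-- The norm of `f` in the weighted space `L^p_w(0,∞)` (as an extended real). -/
noncomputable def lpwNorm (p : ℝ) (w : ℝ → ℝ) (f : ℝ → ℂ) : ℝ≥0∞ :=
  (∫⁻ t in Set.Ioi (0:ℝ), (‖f t‖₊ : ℝ≥0∞) ^ p * ENNReal.ofReal (w t)) ^ (1/p)

/-- Boundedness of the Laplace–Carleson embedding `𝔏 : L^p_w(0,∞) → L^q(ℂ₊, μ)`. -/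
def lcBounded (p q : ℝ) (w : ℝ → ℝ) (μ : Measure ℂ) : Prop :=
  ∃ C > 0, ∀ f : ℝ → ℂ, Measurable f →
    (∫⁻ z, (‖laplaceT f z‖₊ : ℝ≥0∞) ^ q ∂μ) ^ (1/q) ≤ ENNReal.ofReal C * lpwNorm p w f

/-- The sector `S(θ) = {z ∈ ℂ₊ : |arg z| < θ}`. -/
def sector (θ : ℝ) : Set ℂ := {z : ℂ | 0 < z.re ∧ |Complex.arg z| < θ}

/-- The truncated sector `Δ_r = {z ∈ S(θ) : Re z ≤ r}`. -/
def sectorDelta (θ r : ℝ) : Set ℂ := {z ∈ sector θ | z.re ≤ r}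

/-- The Laplace transform of `‖f‖`, as an extended real. -/
noncomputable def absLaplace (f : ℝ → ℂ) (x : ℝ) : ℝ≥0∞ :=
  ∫⁻ t in Set.Ioi (0:ℝ), ‖f t‖ₑ * ENNReal.ofReal (Real.exp (-(x * t)))

lemma enorm_laplaceT_le (f : ℝ → ℂ) (z : ℂ) : ‖laplaceT f z‖ₑ ≤ absLaplace f z.re := by
  refine (enorm_integral_le_lintegral_enorm _).trans (le_of_eq ?_)
  refine lintegral_congr fun t => ?_
  rw [enorm_mul, ← ofReal_norm (Complex.exp _), Complex.norm_exp]
  congr 4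
  simp [mul_comm]

lemma absLaplace_anti (f : ℝ → ℂ) : Antitone (absLaplace f) := by
  intro x y hxy
  refine setLIntegral_mono' measurableSet_Ioi fun t (ht : 0 < t) => ?_
  gcongr

lemma lintegral_rpow_mul_exp {a x : ℝ} (ha : 0 < a) (hx : 0 < x) :
    ∫⁻ t in Set.Ioi (0:ℝ), ENNReal.ofReal (t ^ (a - 1) * Real.exp (-(x * t))) =
      ENNReal.ofReal (Real.Gamma a * x ^ (-a)) := by
  have hval := Real.integral_rpow_mul_exp_neg_mul_Ioi ha hx
  have hpos : 0 < (1 / x) ^ a * Real.Gamma a :=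
    mul_pos (Real.rpow_pos_of_pos (by positivity) _) (Real.Gamma_pos_of_pos ha)
  rw [← ofReal_integral_eq_lintegral_ofReal, hval, Real.rpow_neg hx.le, one_div,
    Real.inv_rpow hx.le, mul_comm]
  · exact Integrable.of_integral_ne_zero (by rw [hval]; exact hpos.ne')
  · filter_upwards [ae_restrict_mem measurableSet_Ioi] with t (ht : 0 < t)
    positivity

/-- Schur-type estimate: Hölder's inequality with the weight `t ^ c`. -/
lemma absLaplace_rpow_le {p c x : ℝ} (hp : 1 < p) (hc : c < 1) (hx : 0 < x) {f : ℝ → ℂ}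
    (hf : Measurable f) :
    absLaplace f x ^ p ≤ ENNReal.ofReal (Real.Gamma (1 - c) ^ (p - 1) * x ^ ((c - 1) * (p - 1))) *
      ∫⁻ t in Set.Ioi (0:ℝ), ‖f t‖ₑ ^ p *
        ENNReal.ofReal (t ^ (c * (p - 1)) * Real.exp (-(x * t))) := by
  have hp0 : 0 < p := by linarith
  have hp1 : 0 < p - 1 := by linarith
  have hG : 0 < Real.Gamma (1 - c) := Real.Gamma_pos_of_pos (by linarith)
  have hpq : p.HolderConjugate (p / (p - 1)) := Real.HolderConjugate.conjExponent hp
  set F : ℝ → ℝ≥0∞ := fun t =>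
    ‖f t‖ₑ * ENNReal.ofReal (t ^ (c * (p - 1) / p) * Real.exp (-(x * t) / p))
  set g : ℝ → ℝ≥0∞ := fun t =>
    ENNReal.ofReal (t ^ (-(c * (p - 1) / p)) * Real.exp (-(x * t) * ((p - 1) / p)))
  have hF : AEMeasurable F (volume.restrict (Set.Ioi 0)) := by
    apply Measurable.aemeasurable; fun_prop
  have hg : AEMeasurable g (volume.restrict (Set.Ioi 0)) := by
    apply Measurable.aemeasurable; fun_prop
  have h1 : absLaplace f x = ∫⁻ t in Set.Ioi (0:ℝ), (F * g) t := by
    refine setLIntegral_congr_fun measurableSet_Ioi fun t (ht : 0 < t) => ?_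
    simp only [F, g, Pi.mul_apply]
    rw [mul_assoc, ← ENNReal.ofReal_mul (by positivity)]
    congr 2
    rw [mul_mul_mul_comm, ← Real.rpow_add ht, ← Real.exp_add, add_neg_cancel, Real.rpow_zero,
      one_mul]
    congr 1
    field_simp
    ring
  have h2 : ∫⁻ t in Set.Ioi (0:ℝ), F t ^ p = ∫⁻ t in Set.Ioi (0:ℝ), ‖f t‖ₑ ^ p *
        ENNReal.ofReal (t ^ (c * (p - 1)) * Real.exp (-(x * t))) := by
    refine setLIntegral_congr_fun measurableSet_Ioi fun t (ht : 0 < t) => ?_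
    simp only [F]
    rw [ENNReal.mul_rpow_of_nonneg _ _ hp0.le, ENNReal.ofReal_rpow_of_nonneg (by positivity) hp0.le,
      Real.mul_rpow (by positivity) (by positivity), ← Real.rpow_mul ht.le, ← Real.exp_mul,
      div_mul_cancel₀ _ hp0.ne', div_mul_cancel₀ _ hp0.ne']
  have h3 : ∫⁻ t in Set.Ioi (0:ℝ), g t ^ (p / (p - 1)) =
      ENNReal.ofReal (Real.Gamma (1 - c) * x ^ (c - 1)) := by
    have := lintegral_rpow_mul_exp (a := 1 - c) (by linarith) hx
    rw [neg_sub] at this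
    rw [← this]
    refine setLIntegral_congr_fun measurableSet_Ioi fun t (ht : 0 < t) => ?_
    simp only [g]
    rw [ENNReal.ofReal_rpow_of_nonneg (by positivity) (by positivity),
      Real.mul_rpow (by positivity) (by positivity), ← Real.rpow_mul ht.le, ← Real.exp_mul]
    congr 3
    · field_simp
      ring
    · field_simp
  have h4 := ENNReal.lintegral_mul_le_Lp_mul_Lq _ hpq hF hg
  rw [← h1, h2, h3] at h4
  refine (ENNReal.rpow_le_rpow h4 hp0.le).trans (le_of_eq ?_)
  rw [ENNReal.mul_rpow_of_nonneg _ _ hp0.le, ← ENNReal.rpow_mul, ← ENNReal.rpow_mul,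
    one_div_mul_cancel hp0.ne', ENNReal.rpow_one, mul_comm]
  congr 1
  rw [show 1 / (p / (p - 1)) * p = p - 1 by field_simp,
    ENNReal.ofReal_rpow_of_nonneg (by positivity) hp1.le,
    Real.mul_rpow hG.le (by positivity), ← Real.rpow_mul hx.le]

/-- The pointwise bound for the Laplace transform on `L^p_{t^α}`. -/
lemma absLaplace_rpow_le_weight {p α x : ℝ} (hp : 1 < p) (hα : α < p - 1) (hx : 0 < x) {f : ℝ → ℂ}
    (hf : Measurable f) :
    absLaplace f x ^ p ≤
      ENNReal.ofReal (Real.Gamma (1 - α / (p - 1)) ^ (p - 1) * x ^ (-(p - 1 - α))) *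
      ∫⁻ t in Set.Ioi (0:ℝ), ‖f t‖ₑ ^ p * ENNReal.ofReal (t ^ α) := by
  have hp1 : 0 < p - 1 := by linarith
  have h := absLaplace_rpow_le hp (c := α / (p - 1)) (by rw [div_lt_one hp1]; exact hα) hx hf
  rw [show (α / (p - 1) - 1) * (p - 1) = -(p - 1 - α) by field_simp; ring,
    div_mul_cancel₀ _ hp1.ne'] at h
  refine h.trans ?_
  refine mul_le_mul_right ?_ _
  refine setLIntegral_mono' measurableSet_Ioi fun t (ht : 0 < t) => ?_
  gcongr
  exact mul_le_of_le_one_right (by positivity) (Real.exp_le_one_iff.2 (by nlinarith))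

/-- A Hardy-type inequality for the Laplace transform. -/
lemma lintegral_absLaplace_rpow_le {p α : ℝ} (hp : 1 < p) (hα : α < p - 1) :
    ∃ K > 0, ∀ f : ℝ → ℂ, Measurable f →
      ∫⁻ x in Set.Ioi (0:ℝ), absLaplace f x ^ p * ENNReal.ofReal (x ^ (p - 1 - α - 1)) ≤
        ENNReal.ofReal K * ∫⁻ t in Set.Ioi (0:ℝ), ‖f t‖ₑ ^ p * ENNReal.ofReal (t ^ α) := by
  have hp1 : 0 < p - 1 := by linarith
  obtain ⟨c, hc⟩ : ∃ c, c = (α / (p - 1) + 1) / 2 := ⟨_, rfl⟩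
  have hα1 : α / (p - 1) < 1 := by rw [div_lt_one hp1]; exact hα
  have hc1 : c < 1 := by linarith
  have hγ : 0 < c * (p - 1) - α := by
    have : c * (p - 1) - α = (p - 1 - α) / 2 := by rw [hc]; field_simp; ring
    rw [this]; linarith
  have hG1 := Real.Gamma_pos_of_pos (sub_pos.2 hc1)
  have hG2 := Real.Gamma_pos_of_pos hγ
  refine ⟨Real.Gamma (1 - c) ^ (p - 1) * Real.Gamma (c * (p - 1) - α), by positivity,
    fun f hf => ?_⟩
  calc
    _ ≤ ∫⁻ x in Set.Ioi (0:ℝ), ∫⁻ t in Set.Ioi (0:ℝ),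
        ENNReal.ofReal (Real.Gamma (1 - c) ^ (p - 1)) *
        (‖f t‖ₑ ^ p * ENNReal.ofReal (t ^ (c * (p - 1))) *
          ENNReal.ofReal (x ^ (c * (p - 1) - α - 1) * Real.exp (-(t * x)))) := by
      refine setLIntegral_mono' measurableSet_Ioi fun x (hx : 0 < x) => ?_
      refine (mul_le_mul_left (absLaplace_rpow_le hp hc1 hx hf) _).trans (le_of_eq ?_)
      rw [mul_right_comm, ← ENNReal.ofReal_mul (by positivity), mul_assoc (_ ^ (p - 1)),
        ← Real.rpow_add hx, ← lintegral_const_mul _ (by fun_prop)]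
      refine setLIntegral_congr_fun measurableSet_Ioi fun t (ht : 0 < t) => ?_
      rw [ENNReal.ofReal_mul (by positivity), ENNReal.ofReal_mul (by positivity),
        ENNReal.ofReal_mul (by positivity), mul_comm t x,
        show (c - 1) * (p - 1) + (p - 1 - α - 1) = c * (p - 1) - α - 1 by ring]
      ring
    _ = ∫⁻ t in Set.Ioi (0:ℝ), ∫⁻ x in Set.Ioi (0:ℝ),
        ENNReal.ofReal (Real.Gamma (1 - c) ^ (p - 1)) *
        (‖f t‖ₑ ^ p * ENNReal.ofReal (t ^ (c * (p - 1))) *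
          ENNReal.ofReal (x ^ (c * (p - 1) - α - 1) * Real.exp (-(t * x)))) := by
      apply lintegral_lintegral_swap
      apply Measurable.aemeasurable
      unfold Function.uncurry
      fun_prop
    _ = ∫⁻ t in Set.Ioi (0:ℝ),
        ENNReal.ofReal (Real.Gamma (1 - c) ^ (p - 1) * Real.Gamma (c * (p - 1) - α)) *
        (‖f t‖ₑ ^ p * ENNReal.ofReal (t ^ α)) := by
      refine setLIntegral_congr_fun measurableSet_Ioi fun t (ht : 0 < t) => ?_
      rw [lintegral_const_mul _ (by fun_prop), lintegral_const_mul _ (by fun_prop),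
        lintegral_rpow_mul_exp hγ ht, ENNReal.ofReal_mul hG2.le, ENNReal.ofReal_mul (by positivity),
        show t ^ α = t ^ (c * (p - 1)) * t ^ (-(c * (p - 1) - α)) by
          rw [← Real.rpow_add ht]; ring_nf, ENNReal.ofReal_mul (by positivity)]
      ring
    _ = _ := lintegral_const_mul _ (by fun_prop)

lemma lintegral_absLaplace_rpow_le_of_le {p q α : ℝ} (hp : 1 < p) (hpq : p ≤ q) (hα : α < p - 1) :
    ∃ K > 0, ∀ f : ℝ → ℂ, Measurable f →
      ∫⁻ x in Set.Ioi (0:ℝ), absLaplace f x ^ q * ENNReal.ofReal (x ^ (q * (p - 1 - α) / p - 1)) ≤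
        ENNReal.ofReal K *
          (∫⁻ t in Set.Ioi (0:ℝ), ‖f t‖ₑ ^ p * ENNReal.ofReal (t ^ α)) ^ (q / p) := by
  have hp1 : 0 < p - 1 := by linarith
  have hp0 : 0 < p := by linarith
  have hr : 0 ≤ (q - p) / p := div_nonneg (by linarith) hp0.le
  obtain ⟨K, hK, h⟩ := lintegral_absLaplace_rpow_le hp hα
  have hα1 : α / (p - 1) < 1 := by rw [div_lt_one hp1]; exact hα
  have hG := Real.Gamma_pos_of_pos (sub_pos.2 hα1)
  set L := Real.Gamma (1 - α / (p - 1)) ^ (p - 1) with hL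
  have hL0 : 0 < L := by positivity
  refine ⟨L ^ ((q - p) / p) * K, by positivity, fun f hf => ?_⟩
  set N := ∫⁻ t in Set.Ioi (0:ℝ), ‖f t‖ₑ ^ p * ENNReal.ofReal (t ^ α)
  have hmeas : Measurable (absLaplace f) := (absLaplace_anti f).measurable
  calc
    _ ≤ ∫⁻ x in Set.Ioi (0:ℝ), ENNReal.ofReal (L ^ ((q - p) / p)) * N ^ ((q - p) / p) *
        (absLaplace f x ^ p * ENNReal.ofReal (x ^ (p - 1 - α - 1))) := by
      refine setLIntegral_mono' measurableSet_Ioi fun x (hx : 0 < x) => ?_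
      have hb := ENNReal.rpow_le_rpow (absLaplace_rpow_le_weight hp hα hx hf) hr
      rw [← hL, ENNReal.mul_rpow_of_nonneg _ _ hr, ← ENNReal.rpow_mul,
        ENNReal.ofReal_rpow_of_nonneg (by positivity) hr, Real.mul_rpow hL0.le (by positivity),
        ← Real.rpow_mul hx.le, ENNReal.ofReal_mul (by positivity)] at hb
      have hq : absLaplace f x ^ q =
          absLaplace f x ^ (p * ((q - p) / p)) * absLaplace f x ^ p := by
        rw [← ENNReal.rpow_add_of_nonneg _ _ (by positivity) hp0.le]
        congr 1
        field_simp
        ring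
      rw [hq]
      refine (mul_le_mul_left (mul_le_mul_left hb _) _).trans (le_of_eq ?_)
      rw [show x ^ (p - 1 - α - 1) =
          x ^ (-(p - 1 - α) * ((q - p) / p)) * x ^ (q * (p - 1 - α) / p - 1) by
        rw [← Real.rpow_add hx]
        congr 1
        field_simp
        ring, ENNReal.ofReal_mul (by positivity)]
      ring
    _ = ENNReal.ofReal (L ^ ((q - p) / p)) * N ^ ((q - p) / p) *
        ∫⁻ x in Set.Ioi (0:ℝ), (absLaplace f x ^ p * ENNReal.ofReal (x ^ (p - 1 - α - 1))) :=
      lintegral_const_mul _ ((hmeas.pow_const _).mul (by fun_prop))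
    _ ≤ ENNReal.ofReal (L ^ ((q - p) / p)) * N ^ ((q - p) / p) * (ENNReal.ofReal K * N) := by
      gcongr
      exact h f hf
    _ = _ := by
      rw [show q / p = (q - p) / p + 1 by field_simp; ring,
        ENNReal.rpow_add_of_nonneg _ _ hr zero_le_one, ENNReal.rpow_one,
        ENNReal.ofReal_mul (by positivity)]
      ring

lemma measurableSet_sector (θ : ℝ) : MeasurableSet (sector θ) :=
  (measurableSet_lt measurable_const Complex.measurable_re).inter
    (measurableSet_lt (continuous_abs.measurable.comp Complex.measurable_arg) measurable_const)

lemma measurableSet_sectorDelta (θ r : ℝ) : MeasurableSet (sectorDelta θ r) :=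
  (measurableSet_sector θ).inter (measurableSet_le Complex.measurable_re measurable_const)

lemma sigmaFinite_of_sectorDelta_lt_top {θ : ℝ} {μ : Measure ℂ} (hsupp : μ ((sector θ)ᶜ) = 0)
    (h : ∀ r > 0, μ (sectorDelta θ r) < ⊤) : SigmaFinite μ := by
  refine ⟨⟨⟨fun n : ℕ => sectorDelta θ (n + 1) ∪ (sector θ)ᶜ, fun _ => trivial, fun n => ?_, ?_⟩⟩⟩
  · refine (measure_union_le _ _).trans_lt ?_
    rw [hsupp, add_zero]
    exact h _ (by positivity)
  · refine eq_univ_of_forall fun z => mem_iUnion.2 ?_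
    obtain ⟨n, hn⟩ := exists_nat_ge z.re
    by_cases hz : z ∈ sector θ
    · exact ⟨n, Or.inl ⟨hz, by linarith⟩⟩
    · exact ⟨n, Or.inr hz⟩

/-- For a decreasing function, the integral against `μ` is controlled by a weighted
Lebesgue integral as soon as `μ (Δ_r) ≤ C r ^ s`. -/
lemma lintegral_antitone_re_le {θ s C : ℝ} (hC : 0 < C) {μ : Measure ℂ}
    (hsupp : μ ((sector θ)ᶜ) = 0)
    (h : ∀ r > 0, μ (sectorDelta θ r) ≤ ENNReal.ofReal (C * r ^ s))
    {G : ℝ → ℝ≥0∞} (hG : Antitone G) :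
    ∫⁻ z, G z.re ∂μ ≤
      ENNReal.ofReal (2 * C * 2 ^ s) * ∫⁻ u in Set.Ioi (0:ℝ), G u * ENNReal.ofReal (u ^ (s - 1)) := by
  have hσ : SigmaFinite μ :=
    sigmaFinite_of_sectorDelta_lt_top hsupp fun r hr => (h r hr).trans_lt ENNReal.ofReal_lt_top
  have hGm := hG.measurable
  have hae : ∀ᵐ z ∂μ, z ∈ sector θ := hsupp
  have hset : MeasurableSet {w : ℂ × ℝ | w.2 ≤ w.1.re ∧ w.1.re ≤ 2 * w.2} :=
    (measurableSet_le (f := fun w : ℂ × ℝ => w.2) (g := fun w => w.1.re)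
      (by fun_prop) (by fun_prop)).inter
      (measurableSet_le (f := fun w : ℂ × ℝ => w.1.re) (g := fun w => 2 * w.2)
        (by fun_prop) (by fun_prop))
  calc
    _ ≤ ∫⁻ z, (∫⁻ u in Set.Ioi (0:ℝ),
        {w : ℂ × ℝ | w.2 ≤ w.1.re ∧ w.1.re ≤ 2 * w.2}.indicator
          (fun w => G w.2 * ENNReal.ofReal (2 * w.2⁻¹)) (z, u)) ∂μ := by
      refine lintegral_mono_ae ?_
      filter_upwards [hae] with z hz
      have hx : 0 < z.re := hz.1
      calc
        G z.re = ∫⁻ u in Set.Icc (z.re / 2) z.re, G z.re * ENNReal.ofReal (2 * z.re⁻¹) := by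
          rw [setLIntegral_const, Real.volume_Icc, mul_assoc, ← ENNReal.ofReal_mul (by positivity),
            show 2 * z.re⁻¹ * (z.re - z.re / 2) = 1 by field_simp; ring, ENNReal.ofReal_one, mul_one]
        _ ≤ ∫⁻ u in Set.Icc (z.re / 2) z.re,
            {w : ℂ × ℝ | w.2 ≤ w.1.re ∧ w.1.re ≤ 2 * w.2}.indicator
              (fun w => G w.2 * ENNReal.ofReal (2 * w.2⁻¹)) (z, u) := by
          refine setLIntegral_mono' measurableSet_Icc fun u hu => ?_
          have hu0 : 0 < u := lt_of_lt_of_le (by positivity) hu.1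
          have hmem : ((z, u) : ℂ × ℝ) ∈ {w : ℂ × ℝ | w.2 ≤ w.1.re ∧ w.1.re ≤ 2 * w.2} :=
            ⟨hu.2, by linarith [hu.1]⟩
          rw [Set.indicator_of_mem hmem]
          have := hG hu.2
          have := hu.2
          gcongr
        _ ≤ _ := lintegral_mono_set fun u hu => lt_of_lt_of_le (by positivity) hu.1
    _ = ∫⁻ u in Set.Ioi (0:ℝ), ∫⁻ z,
        {w : ℂ × ℝ | w.2 ≤ w.1.re ∧ w.1.re ≤ 2 * w.2}.indicator
          (fun w => G w.2 * ENNReal.ofReal (2 * w.2⁻¹)) (z, u) ∂μ := by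
      apply lintegral_lintegral_swap
      apply Measurable.aemeasurable
      unfold Function.uncurry
      exact Measurable.indicator (by fun_prop) hset
    _ ≤ ∫⁻ u in Set.Ioi (0:ℝ),
        ENNReal.ofReal (2 * C * 2 ^ s) * (G u * ENNReal.ofReal (u ^ (s - 1))) := by
      refine setLIntegral_mono' measurableSet_Ioi fun u (hu : 0 < u) => ?_
      calc
        _ ≤ ∫⁻ z, (sectorDelta θ (2 * u)).indicator
            (fun _ => G u * ENNReal.ofReal (2 * u⁻¹)) z ∂μ := by
          refine lintegral_mono_ae ?_
          filter_upwards [hae] with z hz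
          by_cases hzu : z.re ≤ 2 * u
          · rw [Set.indicator_of_mem (show z ∈ sectorDelta θ (2 * u) from ⟨hz, hzu⟩)]
            exact Set.indicator_apply_le fun _ => le_rfl
          · rw [Set.indicator_of_notMem (fun hw => hzu hw.2)]
            exact zero_le
        _ = G u * ENNReal.ofReal (2 * u⁻¹) * μ (sectorDelta θ (2 * u)) :=
          lintegral_indicator_const (measurableSet_sectorDelta _ _) _
        _ ≤ G u * ENNReal.ofReal (2 * u⁻¹) * ENNReal.ofReal (C * (2 * u) ^ s) := by
          gcongr
          exact h _ (by positivity)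
        _ = _ := by
          rw [mul_assoc, mul_left_comm (ENNReal.ofReal (2 * C * 2 ^ s)),
            ← ENNReal.ofReal_mul (by positivity), ← ENNReal.ofReal_mul (by positivity), Real.mul_rpow zero_le_two hu.le,
            Real.rpow_sub_one hu.ne']
          congr 2
          field_simp
    _ = _ := lintegral_const_mul _ (by fun_prop)

lemma lcBounded_of_sectorDelta_le {p q α θ C : ℝ} (hp : 1 < p) (hpq : p ≤ q) (hα : α < p - 1)
    {μ : Measure ℂ} (hsupp : μ ((sector θ)ᶜ) = 0) (hC : 0 < C)
    (h : ∀ r > 0, μ (sectorDelta θ r) ≤ ENNReal.ofReal (C * r ^ (q * (p - 1 - α) / p))) :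
    lcBounded p q (fun t => t ^ α) μ := by
  have hq : 0 < q := by linarith
  obtain ⟨K, hK, hb⟩ := lintegral_absLaplace_rpow_le_of_le hp hpq hα
  set s := q * (p - 1 - α) / p
  refine ⟨(2 * C * 2 ^ s * K) ^ (1 / q), by positivity, fun f hf => ?_⟩
  have hG : Antitone fun x => absLaplace f x ^ q :=
    fun x y hxy => ENNReal.rpow_le_rpow (absLaplace_anti f hxy) hq.le
  have h1 : ∫⁻ z, (‖laplaceT f z‖₊ : ℝ≥0∞) ^ q ∂μ ≤ ∫⁻ z, absLaplace f z.re ^ q ∂μ :=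
    lintegral_mono fun z => ENNReal.rpow_le_rpow (enorm_laplaceT_le f z) hq.le
  have h2 := h1.trans ((lintegral_antitone_re_le hC hsupp h hG).trans
    (mul_le_mul_right (hb f hf) _))
  refine (ENNReal.rpow_le_rpow h2 (by positivity)).trans (le_of_eq ?_)
  rw [← mul_assoc, ← ENNReal.ofReal_mul (by positivity),
    ENNReal.mul_rpow_of_nonneg _ _ (by positivity), ← ENNReal.rpow_mul,
    ENNReal.ofReal_rpow_of_nonneg (by positivity) (by positivity),
    show q / p * (1 / q) = 1 / p by field_simp]
  rfl

lemma norm_le_of_mem_sectorDelta {θ r : ℝ} (hθ : θ < Real.pi / 2) {z : ℂ}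
    (hz : z ∈ sectorDelta θ r) : ‖z‖ * Real.cos θ ≤ r := by
  have hcos : Real.cos θ ≤ Real.cos (Complex.arg z) := by
    rw [← Real.cos_abs (Complex.arg z)]
    exact Real.cos_le_cos_of_nonneg_of_le_pi (abs_nonneg _) (by linarith [Real.pi_pos]) hz.1.2.le
  calc
    ‖z‖ * Real.cos θ ≤ ‖z‖ * Real.cos (Complex.arg z) := by gcongr
    _ = z.re := Complex.norm_mul_cos_arg z
    _ ≤ r := hz.2

lemma le_norm_laplaceT_indicator {a : ℝ} (ha : 0 < a) {z : ℂ} (hz : a * ‖z‖ ≤ 1 / 8) :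
    a / 2 ≤ ‖laplaceT ((Set.Ioc a (2 * a)).indicator 1) z‖ := by
  have hvol : volume.real (Set.Ioc a (2 * a)) = a := by
    rw [Real.volume_real_Ioc_of_le (by linarith)]; ring
  have heq : laplaceT ((Set.Ioc a (2 * a)).indicator 1) z =
      ∫ t in Set.Ioc a (2 * a), Complex.exp (-(t : ℂ) * z) := by
    have hfun : (fun t : ℝ => (Set.Ioc a (2 * a)).indicator (1 : ℝ → ℂ) t *
        Complex.exp (-(t : ℂ) * z)) =
        (Set.Ioc a (2 * a)).indicator fun t : ℝ => Complex.exp (-(t : ℂ) * z) := by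
      funext t
      by_cases ht : t ∈ Set.Ioc a (2 * a) <;> simp [ht]
    rw [laplaceT, hfun, setIntegral_indicator measurableSet_Ioc,
      inter_eq_right.2 (Ioc_subset_Ioi_self.trans (Ioi_subset_Ioi ha.le))]
  have hint : IntegrableOn (fun t : ℝ => Complex.exp (-(t : ℂ) * z)) (Set.Ioc a (2 * a)) :=
    (Continuous.integrableOn_Icc (by fun_prop)).mono_set Ioc_subset_Icc_self
  have hdiff : ‖∫ t in Set.Ioc a (2 * a), (Complex.exp (-(t : ℂ) * z) - 1)‖ ≤ 1 / 2 * a := by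
    have := norm_setIntegral_le_of_norm_le_const (μ := volume) (s := Set.Ioc a (2 * a))
      (f := fun t : ℝ => Complex.exp (-(t : ℂ) * z) - 1) (C := 1 / 2)
      (by simp) fun t ht => ?_
    · rwa [hvol] at this
    have ht0 : 0 < t := ha.trans ht.1
    have hn : ‖-(t : ℂ) * z‖ ≤ 1 / 4 := by
      rw [norm_mul, norm_neg, Complex.norm_real, Real.norm_of_nonneg ht0.le]
      nlinarith [norm_nonneg z, mul_le_mul_of_nonneg_right ht.2 (norm_nonneg z)]
    linarith [Complex.norm_exp_sub_one_le (hn.trans (by norm_num))]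
  rw [integral_sub hint (by simp), setIntegral_const, hvol, ← heq] at hdiff
  have hnorm : ‖(a • (1 : ℂ))‖ = a := by simp [abs_of_pos ha]
  have := norm_sub_norm_le (a • (1 : ℂ)) (laplaceT ((Set.Ioc a (2 * a)).indicator 1) z)
  rw [norm_sub_rev, hnorm] at this
  linarith

lemma lpwNorm_indicator_le {p α a : ℝ} (hp : 0 < p) (ha : 0 < a) :
    lpwNorm p (fun t => t ^ α) ((Set.Ioc a (2 * a)).indicator 1) ≤
      ENNReal.ofReal (((1 + 2 ^ α) * a ^ (α + 1)) ^ (1 / p)) := by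
  rw [← ENNReal.ofReal_rpow_of_nonneg (by positivity) (by positivity)]
  refine ENNReal.rpow_le_rpow ?_ (by positivity)
  calc
    _ ≤ ∫⁻ t in Set.Ioi (0:ℝ), (Set.Ioc a (2 * a)).indicator
        (fun _ => ENNReal.ofReal ((1 + 2 ^ α) * a ^ α)) t := by
      refine setLIntegral_mono' measurableSet_Ioi fun t _ => ?_
      by_cases ht : t ∈ Set.Ioc a (2 * a)
      · have hbound : t ^ α ≤ (1 + 2 ^ α) * a ^ α := by
          rw [add_mul, one_mul, ← Real.mul_rpow zero_le_two ha.le]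
          rcases le_total 0 α with h | h
          · have := Real.rpow_le_rpow (ha.trans ht.1).le ht.2 h
            have := Real.rpow_nonneg ha.le α
            linarith
          · have := Real.rpow_le_rpow_of_nonpos ha ht.1.le h
            have : 0 ≤ (2 * a) ^ α := by positivity
            linarith
        simpa [ht] using ENNReal.ofReal_le_ofReal hbound
      · simp [ht, hp]
    _ ≤ ∫⁻ t, (Set.Ioc a (2 * a)).indicator
        (fun _ => ENNReal.ofReal ((1 + 2 ^ α) * a ^ α)) t := setLIntegral_le_lintegral _ _
    _ = _ := by
      rw [lintegral_indicator_const measurableSet_Ioc, Real.volume_Ioc,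
        ← ENNReal.ofReal_mul (by positivity), Real.rpow_add_one ha.ne']
      congr 1
      ring

lemma sectorDelta_le_of_lcBounded {p q α θ : ℝ} (hp : 0 < p) (hq : 0 < q) (hθ0 : 0 ≤ θ)
    (hθ : θ < Real.pi / 2) {μ : Measure ℂ} (h : lcBounded p q (fun t => t ^ α) μ) :
    ∃ C > 0, ∀ r > 0,
      μ (sectorDelta θ r) ≤ ENNReal.ofReal (C * r ^ (q * (p - 1 - α) / p)) := by
  obtain ⟨C, hC, hb⟩ := h
  have hcos : 0 < Real.cos θ := Real.cos_pos_of_mem_Ioo ⟨by linarith [Real.pi_pos], hθ⟩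
  obtain ⟨c, hc⟩ : ∃ c, c = Real.cos θ / 8 := ⟨_, rfl⟩
  have hc0 : 0 < c := by rw [hc]; positivity
  refine ⟨(2 * C * (1 + 2 ^ α) ^ (1 / p) * c ^ ((α + 1) / p - 1)) ^ q, by positivity,
    fun r hr => ?_⟩
  obtain ⟨a, ha⟩ : ∃ a, a = c / r := ⟨_, rfl⟩
  have ha0 : 0 < a := by rw [ha]; positivity
  have hlow : ∀ z ∈ sectorDelta θ r, ENNReal.ofReal (a / 2) ≤
      ‖laplaceT ((Set.Ioc a (2 * a)).indicator 1) z‖₊ := by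
    intro z hz
    have hz' : a * ‖z‖ ≤ 1 / 8 := by
      rw [ha, hc, div_div, div_mul_eq_mul_div, div_le_div_iff₀ (by positivity) (by norm_num)]
      linarith [norm_le_of_mem_sectorDelta hθ hz]
    exact (ENNReal.ofReal_le_ofReal (le_norm_laplaceT_indicator ha0 hz')).trans_eq
      (ofReal_norm _)
  have h1 := (hb _ (measurable_one.indicator measurableSet_Ioc)).trans
    (mul_le_mul_right (lpwNorm_indicator_le (α := α) hp ha0) _)
  rw [← ENNReal.ofReal_mul hC.le] at h1
  have h2 : ENNReal.ofReal ((a / 2) ^ q) * μ (sectorDelta θ r) ≤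
      ENNReal.ofReal ((C * ((1 + 2 ^ α) * a ^ (α + 1)) ^ (1 / p)) ^ q) := by
    calc
      _ = ∫⁻ _ in sectorDelta θ r, ENNReal.ofReal (a / 2) ^ q ∂μ := by
        rw [setLIntegral_const, ENNReal.ofReal_rpow_of_nonneg (by positivity) hq.le]
      _ ≤ ∫⁻ z in sectorDelta θ r,
          (‖laplaceT ((Set.Ioc a (2 * a)).indicator 1) z‖₊ : ℝ≥0∞) ^ q ∂μ :=
        setLIntegral_mono' (measurableSet_sectorDelta _ _) fun z hz =>
          ENNReal.rpow_le_rpow (hlow z hz) hq.le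
      _ ≤ ∫⁻ z, (‖laplaceT ((Set.Ioc a (2 * a)).indicator 1) z‖₊ : ℝ≥0∞) ^ q ∂μ :=
        setLIntegral_le_lintegral _ _
      _ ≤ _ := by
        rw [← ENNReal.ofReal_rpow_of_nonneg (by positivity) hq.le]
        rwa [one_div, ENNReal.rpow_inv_le_iff hq] at h1
  rw [mul_comm, ← ENNReal.le_div_iff_mul_le (Or.inl (by simp; positivity)) (by simp),
    ← ENNReal.ofReal_div_of_pos (by positivity)] at h2
  refine h2.trans_eq (congrArg _ ?_)
  rw [← Real.div_rpow (by positivity) (by positivity),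
    show q * (p - 1 - α) / p = (-((α + 1) / p - 1)) * q by field_simp; ring,
    Real.rpow_mul hr.le, ← Real.mul_rpow (by positivity) (by positivity)]
  congr 1
  rw [Real.mul_rpow (by positivity) (by positivity), ← Real.rpow_mul ha0.le, mul_one_div,
    Real.rpow_neg hr.le, ← div_eq_mul_inv, mul_div_assoc _ (c ^ _), ← Real.div_rpow hc0.le hr.le,
    ← ha, Real.rpow_sub_one ha0.ne']
  field_simp

/-- for `1 < p ≤ q < ∞`, `α < p-1` and a positive Borel measure `μ`
supported in the sector `S(θ)`, `0 ≤ θ < π/2`, the Laplace–Carleson embedding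
`𝔏 : L^p_{t^α}(0,∞) → L^q(ℂ₊,μ)` is bounded iff
`μ(Δ_r) ≤ C r^{(q/p')(1-α/(p-1))}` for all `r > 0`. -/
theorem laplace_carleson_sectorial_iff
    (p q α θ : ℝ) (hp : 1 < p) (hpq : p ≤ q)
    (hθ0 : 0 ≤ θ) (hθ : θ < Real.pi / 2) (hα : α < p - 1)
    (μ : Measure ℂ) (hsupp : μ ((sector θ)ᶜ) = 0) :
    lcBounded p q (fun t => t ^ α) μ ↔
      ∃ C > 0, ∀ r > 0,
        μ (sectorDelta θ r) ≤
          ENNReal.ofReal (C * r ^ ((q / (p / (p - 1))) * (1 - α / (p - 1)))) := by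
  rw [show q / (p / (p - 1)) * (1 - α / (p - 1)) = q * (p - 1 - α) / p by
    have : p - 1 ≠ 0 := by linarith
    field_simp]
  refine ⟨sectorDelta_le_of_lcBounded (by linarith) (by linarith) hθ0 hθ, ?_⟩
  rintro ⟨C, hC, h⟩
  exact lcBounded_of_sectorDelta_le hp hpq hα hsupp hC h
end

section
/- Let 1 < p ≤ q < ∞, let w be a measurable weight on (0,∞), and let μ be a positive Borel measure on ℂ₊ supported in the sector S(θ) for some 0 ≤ θ < π/2. Suppose that sup_{t>0} t^α / w(t) < ∞ for some α < p − 1. If there exist r₀ > 0 and a constant C > 0 such that μ(Δ_{2ⁿ r₀}) ≤ C (2ⁿ r₀)^{(q/p′)(1 − α/(p−1))} for every n ∈ ℤ, then the Laplace–Carleson embedding 𝔏 : L^p_w(0,∞) → L^q(ℂ₊, μ) is well-defined and bounded. -/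
open MeasureTheory Set Complex Filter ENNReal

lemma ENNReal.tsum_rpow_le_rpow_tsum {ι : Type*} (a : ι → ℝ≥0∞) {p q : ℝ} (hp : 0 < p)
    (hpq : p ≤ q) : ∑' i, a i ^ q ≤ (∑' i, a i ^ p) ^ (q / p) := by
  set S := ∑' i, a i ^ p
  have h1 : 0 ≤ q / p - 1 := by
    rw [sub_nonneg, le_div_iff₀ hp]; linarith
  have hterm (i : ι) : a i ^ q ≤ a i ^ p * S ^ (q / p - 1) := by
    have : a i ^ q = a i ^ p * (a i ^ p) ^ (q / p - 1) := by
      rw [← ENNReal.rpow_mul,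
        ← ENNReal.rpow_add_of_nonneg _ _ hp.le (mul_nonneg hp.le h1)]
      congr 1
      field_simp
      ring
    rw [this]
    gcongr
    exact ENNReal.le_tsum i
  calc ∑' i, a i ^ q ≤ ∑' i, a i ^ p * S ^ (q / p - 1) := ENNReal.tsum_le_tsum hterm
    _ = S ^ (1 : ℝ) * S ^ (q / p - 1) := by rw [ENNReal.tsum_mul_right, ENNReal.rpow_one]
    _ = S ^ (q / p) := by
      rw [← ENNReal.rpow_add_of_nonneg _ _ zero_le_one h1]; congr 1; ring

lemma lintegral_rpow_mul_exp_neg_mul {c x : ℝ} (hc : 0 < c) (hx : 0 < x) :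
    ∫⁻ t in Ioi (0 : ℝ), ENNReal.ofReal (t ^ (c - 1) * Real.exp (-(x * t))) =
      ENNReal.ofReal (x ^ (-c) * Real.Gamma c) := by
  have h := Real.integral_rpow_mul_exp_neg_mul_Ioi hc hx
  rw [one_div, Real.inv_rpow hx.le, ← Real.rpow_neg hx.le] at h
  rw [← h, ofReal_integral_eq_lintegral_ofReal]
  · refine Integrable.of_integral_ne_zero ?_
    rw [h]
    have := Real.Gamma_pos_of_pos hc
    positivity
  · filter_upwards [ae_restrict_mem measurableSet_Ioi] with t ht
    have : 0 < t := ht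
    positivity

lemma iUnion_Ioc_zpow_mul {r : ℝ} (hr : 0 < r) :
    ⋃ n : ℤ, Ioc ((2 : ℝ) ^ n * r) (2 ^ (n + 1) * r) = Ioi 0 := by
  ext x
  simp only [mem_iUnion, mem_Ioi]
  constructor
  · rintro ⟨n, hn, -⟩
    exact lt_trans (by positivity) hn
  · intro hx
    obtain ⟨n, h1, h2⟩ := exists_mem_Ioc_zpow (div_pos hx hr) (one_lt_two (α := ℝ))
    exact ⟨n, (lt_div_iff₀ hr).1 h1, (div_le_iff₀ hr).1 h2⟩

lemma tsum_zpow_rpow_mul_exp_le {δ t r : ℝ} (hδ : 0 < δ) (ht : 0 < t) (hr : 0 < r) :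
    ∑' n : ℤ, ENNReal.ofReal (((2 : ℝ) ^ n * r) ^ δ * Real.exp (-(t * (2 ^ n * r)))) ≤
      ENNReal.ofReal (2 ^ (δ + 1) * (t ^ (-δ) * Real.Gamma δ)) := by
  have h2 : (0 : ℝ) < 2 ^ (δ + 1) := by positivity
  rw [ENNReal.ofReal_mul h2.le, ← lintegral_rpow_mul_exp_neg_mul hδ ht,
    ← iUnion_Ioc_zpow_mul hr, lintegral_iUnion (fun _ ↦ measurableSet_Ioc),
    ← ENNReal.tsum_mul_left, ← (Equiv.addRight (1 : ℤ)).tsum_eq]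
  · refine ENNReal.tsum_le_tsum fun n ↦ ?_
    set y := (2 : ℝ) ^ n * r with hy
    have hy0 : 0 < y := by positivity
    have hy2 : (2 : ℝ) ^ (n + 1) * r = 2 * y := by
      rw [zpow_add_one₀ two_ne_zero, hy]; ring
    simp only [Equiv.coe_addRight, hy2]
    have hpt : ∀ x ∈ Ioc y (2 * y),
        ENNReal.ofReal (y ^ δ / (2 * y) * Real.exp (-(t * (2 * y)))) ≤
          ENNReal.ofReal (x ^ (δ - 1) * Real.exp (-(t * x))) := by
      intro x hx
      have hx0 : 0 < x := hy0.trans hx.1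
      refine ENNReal.ofReal_le_ofReal ?_
      rw [Real.rpow_sub_one hx0.ne']
      gcongr
      · exact hx.1.le
      · exact hx.2
      · exact hx.2
    calc _ = ENNReal.ofReal (2 ^ (δ + 1)) *
          (ENNReal.ofReal (y ^ δ / (2 * y) * Real.exp (-(t * (2 * y)))) *
            volume (Ioc y (2 * y))) := by
          rw [Real.volume_Ioc, ← ENNReal.ofReal_mul (by positivity),
            ← ENNReal.ofReal_mul h2.le, Real.mul_rpow two_pos.le hy0.le,
            Real.rpow_add_one two_ne_zero]
          congr 1
          field_simp
          ring
      _ ≤ _ := by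
          gcongr
          rw [← setLIntegral_const]
          exact setLIntegral_mono' measurableSet_Ioc hpt
  · intro m n hmn
    have hmono : Monotone fun n : ℤ ↦ (2 : ℝ) ^ n * r := fun a b hab ↦ by
      dsimp only
      gcongr
      exact one_le_two
    exact hmono.pairwise_disjoint_on_Ioc_succ hmn

/-- Hölder's inequality for the Laplace transform, with the power weight `t ^ b`. -/
lemma lintegral_mul_exp_rpow_le {p b x : ℝ} (hp : 1 < p) (hb : b < p - 1) (hx : 0 < x)
    {g : ℝ → ℝ≥0∞} (hg : Measurable g) :
    (∫⁻ t in Ioi (0 : ℝ), g t * ENNReal.ofReal (Real.exp (-(t * x)))) ^ p ≤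
      (∫⁻ t in Ioi (0 : ℝ), g t ^ p * ENNReal.ofReal (t ^ b * Real.exp (-(t * x)))) *
        ENNReal.ofReal (x ^ (b - (p - 1)) * Real.Gamma (1 - b / (p - 1)) ^ (p - 1)) := by
  have hp0 : 0 < p := by linarith
  have hp1 : 0 < p - 1 := by linarith
  have hc : 0 < 1 - b / (p - 1) := by
    rw [sub_pos, div_lt_one hp1]; exact hb
  have hconj : p.HolderConjugate (p / (p - 1)) := Real.HolderConjugate.conjExponent hp
  set u : ℝ → ℝ≥0∞ := fun t ↦ g t * ENNReal.ofReal (t ^ (b / p) * Real.exp (-(t * x) / p))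
  set v : ℝ → ℝ≥0∞ := fun t ↦
    ENNReal.ofReal (t ^ (-(b / p)) * Real.exp (-(t * x) * ((p - 1) / p)))
  have huv : ∫⁻ t in Ioi (0 : ℝ), g t * ENNReal.ofReal (Real.exp (-(t * x))) =
      ∫⁻ t in Ioi (0 : ℝ), (u * v) t := by
    refine setLIntegral_congr_fun measurableSet_Ioi fun t ht ↦ ?_
    have ht : 0 < t := ht
    simp only [Pi.mul_apply, u, v]
    rw [mul_assoc, ← ENNReal.ofReal_mul (by positivity)]
    congr 2
    rw [mul_mul_mul_comm, ← Real.rpow_add ht, ← Real.exp_add, add_neg_cancel, Real.rpow_zero,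
      one_mul]
    congr 1
    field_simp
    ring
  have hu : ∫⁻ t in Ioi (0 : ℝ), u t ^ p =
      ∫⁻ t in Ioi (0 : ℝ), g t ^ p * ENNReal.ofReal (t ^ b * Real.exp (-(t * x))) := by
    refine setLIntegral_congr_fun measurableSet_Ioi fun t ht ↦ ?_
    have ht : 0 < t := ht
    simp only [u]
    rw [ENNReal.mul_rpow_of_nonneg _ _ hp0.le, ENNReal.ofReal_rpow_of_pos (by positivity),
      Real.mul_rpow (by positivity) (by positivity), ← Real.rpow_mul ht.le, ← Real.exp_mul,
      div_mul_cancel₀ _ hp0.ne', div_mul_cancel₀ _ hp0.ne']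
  have hv : ∫⁻ t in Ioi (0 : ℝ), v t ^ (p / (p - 1)) =
      ENNReal.ofReal (x ^ (-(1 - b / (p - 1))) * Real.Gamma (1 - b / (p - 1))) := by
    rw [← lintegral_rpow_mul_exp_neg_mul hc hx]
    refine setLIntegral_congr_fun measurableSet_Ioi fun t ht ↦ ?_
    have ht : 0 < t := ht
    simp only [v]
    rw [ENNReal.ofReal_rpow_of_pos (by positivity),
      Real.mul_rpow (by positivity) (by positivity), ← Real.rpow_mul ht.le, ← Real.exp_mul]
    congr 3
    · field_simp
      ring
    · field_simp
  have hmu : AEMeasurable u (volume.restrict (Ioi 0)) := by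
    refine Measurable.aemeasurable ?_
    fun_prop
  have hmv : AEMeasurable v (volume.restrict (Ioi 0)) := by
    refine Measurable.aemeasurable ?_
    fun_prop
  have hG := Real.Gamma_pos_of_pos hc
  calc _ ≤ ((∫⁻ t in Ioi (0 : ℝ), u t ^ p) ^ (1 / p) *
        (∫⁻ t in Ioi (0 : ℝ), v t ^ (p / (p - 1))) ^ (1 / (p / (p - 1)))) ^ p := by
        rw [huv]
        gcongr
        exact ENNReal.lintegral_mul_le_Lp_mul_Lq _ hconj hmu hmv
    _ = _ := by
        rw [hu, hv, ENNReal.mul_rpow_of_nonneg _ _ hp0.le, ← ENNReal.rpow_mul,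
          ← ENNReal.rpow_mul, one_div_mul_cancel hp0.ne', ENNReal.rpow_one,
          ENNReal.ofReal_rpow_of_pos (by positivity),
          Real.mul_rpow (by positivity) (by positivity), ← Real.rpow_mul hx.le]
        congr 4
        · field_simp
          ring
        · field_simp

/-- A dyadic Hardy inequality for the Laplace transform. -/
lemma exists_tsum_lintegral_mul_exp_rpow_le {p α r : ℝ} (hp : 1 < p) (hα : α < p - 1)
    (hr : 0 < r) : ∃ K : ℝ, 0 < K ∧ ∀ g : ℝ → ℝ≥0∞, Measurable g →
      ∑' n : ℤ, ((∫⁻ t in Ioi (0 : ℝ), g t * ENNReal.ofReal (Real.exp (-(t * (2 ^ n * r))))) *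
          ENNReal.ofReal (((2 : ℝ) ^ n * r) ^ ((p - 1 - α) / p))) ^ p ≤
        ENNReal.ofReal K * ∫⁻ t in Ioi (0 : ℝ), g t ^ p * ENNReal.ofReal (t ^ α) := by
  have hp0 : 0 < p := by linarith
  have hp1 : 0 < p - 1 := by linarith
  obtain ⟨b, hαb, hb⟩ := exists_between hα
  have hc : 0 < 1 - b / (p - 1) := by
    rw [sub_pos, div_lt_one hp1]; exact hb
  have hδ : 0 < b - α := by linarith
  have hG := Real.Gamma_pos_of_pos hc
  have hG' := Real.Gamma_pos_of_pos hδ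
  set K₁ := Real.Gamma (1 - b / (p - 1)) ^ (p - 1)
  have hK₁ : 0 < K₁ := by positivity
  set K₂ := (2 : ℝ) ^ (b - α + 1) * Real.Gamma (b - α)
  have hK₂ : 0 < K₂ := by positivity
  refine ⟨K₁ * K₂, by positivity, fun g hg ↦ ?_⟩
  have hterm (n : ℤ) :
      ((∫⁻ t in Ioi (0 : ℝ), g t * ENNReal.ofReal (Real.exp (-(t * (2 ^ n * r))))) *
          ENNReal.ofReal (((2 : ℝ) ^ n * r) ^ ((p - 1 - α) / p))) ^ p ≤
        ENNReal.ofReal K₁ * ∫⁻ t in Ioi (0 : ℝ), g t ^ p * ENNReal.ofReal (t ^ b) *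
          ENNReal.ofReal (((2 : ℝ) ^ n * r) ^ (b - α) * Real.exp (-(t * (2 ^ n * r)))) := by
    set x := (2 : ℝ) ^ n * r
    have hx : 0 < x := by positivity
    rw [ENNReal.mul_rpow_of_nonneg _ _ hp0.le, ENNReal.ofReal_rpow_of_pos (by positivity),
      ← Real.rpow_mul hx.le, div_mul_cancel₀ _ hp0.ne']
    calc _ ≤ (∫⁻ t in Ioi (0 : ℝ), g t ^ p * ENNReal.ofReal (t ^ b * Real.exp (-(t * x)))) *
          ENNReal.ofReal (x ^ (b - (p - 1)) * K₁) * ENNReal.ofReal (x ^ (p - 1 - α)) := by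
          gcongr
          exact lintegral_mul_exp_rpow_le hp hb hx hg
      _ = ENNReal.ofReal K₁ * (ENNReal.ofReal (x ^ (b - α)) *
          ∫⁻ t in Ioi (0 : ℝ), g t ^ p * ENNReal.ofReal (t ^ b * Real.exp (-(t * x)))) := by
          rw [mul_assoc, ← ENNReal.ofReal_mul (by positivity), ← mul_assoc,
            ← ENNReal.ofReal_mul (by positivity), mul_comm]
          congr 2
          rw [mul_right_comm, ← Real.rpow_add hx, mul_comm]
          congr 2
          ring
      _ = _ := by
          rw [← lintegral_const_mul _ (by fun_prop)]
          congr 1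
          refine setLIntegral_congr_fun measurableSet_Ioi fun t ht ↦ ?_
          have ht : 0 < t := ht
          rw [ENNReal.ofReal_mul (by positivity), ENNReal.ofReal_mul (by positivity)]
          ring
  calc _ ≤ _ := ENNReal.tsum_le_tsum hterm
    _ = ENNReal.ofReal K₁ * ∫⁻ t in Ioi (0 : ℝ), g t ^ p * ENNReal.ofReal (t ^ b) *
          ∑' n : ℤ, ENNReal.ofReal
            (((2 : ℝ) ^ n * r) ^ (b - α) * Real.exp (-(t * (2 ^ n * r)))) := by
        rw [ENNReal.tsum_mul_left, ← lintegral_tsum fun n ↦ Measurable.aemeasurable (by fun_prop)]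
        simp_rw [ENNReal.tsum_mul_left]
    _ ≤ ENNReal.ofReal K₁ * ∫⁻ t in Ioi (0 : ℝ),
          ENNReal.ofReal K₂ * (g t ^ p * ENNReal.ofReal (t ^ α)) := by
        refine mul_le_mul_right ?_ _
        refine setLIntegral_mono' measurableSet_Ioi fun t ht ↦ ?_
        have ht : 0 < t := ht
        calc _ ≤ g t ^ p * ENNReal.ofReal (t ^ b) * ENNReal.ofReal
              (2 ^ (b - α + 1) * (t ^ (-(b - α)) * Real.Gamma (b - α))) := by
              gcongr
              exact tsum_zpow_rpow_mul_exp_le hδ ht hr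
          _ = g t ^ p * ENNReal.ofReal (t ^ b * t ^ (-(b - α)) * K₂) := by
              rw [mul_assoc, ← ENNReal.ofReal_mul (by positivity)]
              congr 2
              ring
          _ = _ := by
              rw [← Real.rpow_add ht, mul_comm _ K₂, ENNReal.ofReal_mul hK₂.le, mul_left_comm]
              congr 4
              ring
    _ = _ := by
        rw [lintegral_const_mul _ (by fun_prop), ← mul_assoc, ENNReal.ofReal_mul hK₁.le]

lemma enorm_laplaceT_le_s11 (f : ℝ → ℂ) {x : ℝ} {z : ℂ} (hz : x ≤ z.re) :
    ‖laplaceT f z‖ₑ ≤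
      ∫⁻ t in Ioi (0 : ℝ), ‖f t‖ₑ * ENNReal.ofReal (Real.exp (-(t * x))) := by
  refine (enorm_integral_le_lintegral_enorm _).trans ?_
  refine setLIntegral_mono' measurableSet_Ioi fun t ht ↦ ?_
  have ht : 0 < t := ht
  rw [enorm_mul]
  gcongr
  rw [← ofReal_norm, Complex.norm_exp]
  refine ENNReal.ofReal_le_ofReal (Real.exp_le_exp.2 ?_)
  simp only [neg_mul, neg_re, re_ofReal_mul]
  gcongr

lemma lintegral_laplaceT_rpow_le {q θ r : ℝ} (hq : 0 ≤ q) (hr : 0 < r) {μ : Measure ℂ}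
    (hsupp : μ (sector θ)ᶜ = 0) (f : ℝ → ℂ) :
    ∫⁻ z, ‖laplaceT f z‖ₑ ^ q ∂μ ≤
      ∑' n : ℤ, (∫⁻ t in Ioi (0 : ℝ),
        ‖f t‖ₑ * ENNReal.ofReal (Real.exp (-(t * (2 ^ n * r))))) ^ q *
          μ (sectorDelta θ (2 ^ (n + 1) * r)) := by
  set A : ℤ → Set ℂ := fun n ↦ sector θ ∩ re ⁻¹' Ioc ((2 : ℝ) ^ n * r) (2 ^ (n + 1) * r)
  have hA (n : ℤ) : MeasurableSet (A n) :=
    (measurableSet_sector θ).inter (measurable_re measurableSet_Ioc)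
  have hU : sector θ = ⋃ n, A n := by
    rw [← inter_iUnion, ← preimage_iUnion, iUnion_Ioc_zpow_mul hr]
    exact (inter_eq_left.2 fun z hz ↦ hz.1).symm
  calc _ = ∫⁻ z in sector θ, ‖laplaceT f z‖ₑ ^ q ∂μ := by
        rw [← lintegral_add_compl _ (measurableSet_sector θ),
          setLIntegral_measure_zero _ _ hsupp, add_zero]
    _ ≤ ∑' n, ∫⁻ z in A n, ‖laplaceT f z‖ₑ ^ q ∂μ := by
        rw [hU]
        exact lintegral_iUnion_le _ _
    _ ≤ _ := by
        refine ENNReal.tsum_le_tsum fun n ↦ ?_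
        calc _ ≤ ∫⁻ _ in A n, (∫⁻ t in Ioi (0 : ℝ),
              ‖f t‖ₑ * ENNReal.ofReal (Real.exp (-(t * (2 ^ n * r))))) ^ q ∂μ := by
              refine setLIntegral_mono' (hA n) fun z hz ↦ ?_
              gcongr
              exact enorm_laplaceT_le_s11 f hz.2.1.le
          _ ≤ _ := by
              rw [setLIntegral_const]
              gcongr
              exact fun z hz ↦ ⟨hz.1, hz.2.2⟩

/-- for `1 < p ≤ q < ∞`, a weight `w` with `sup_{t>0} t^α/w(t) < ∞`
for some `α < p-1`, and `μ` supported in a sector `S(θ)`: if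
`μ(Δ_{2ⁿ r₀}) ≤ C (2ⁿ r₀)^{(q/p')(1-α/(p-1))}` for all `n ∈ ℤ`, then the
Laplace–Carleson embedding `𝔏 : L^p_w(0,∞) → L^q(ℂ₊,μ)` is bounded. -/
theorem laplace_carleson_bounded_of_dyadic_sector_bounds
    (p q α θ : ℝ) (hp : 1 < p) (hpq : p ≤ q)
    (hθ0 : 0 ≤ θ) (hθ : θ < Real.pi / 2) (hα : α < p - 1)
    (w : ℝ → ℝ) (hw : Measurable w) (hwpos : ∀ t > 0, 0 < w t)
    (hsup : ∃ M : ℝ, ∀ t > 0, t ^ α / w t ≤ M)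
    (μ : Measure ℂ) (hsupp : μ ((sector θ)ᶜ) = 0)
    (hdyadic : ∃ r₀ > 0, ∃ C > 0, ∀ n : ℤ,
      μ (sectorDelta θ ((2 : ℝ) ^ n * r₀)) ≤
        ENNReal.ofReal (C * ((2 : ℝ) ^ n * r₀) ^ ((q / (p / (p - 1))) * (1 - α / (p - 1))))) :
    lcBounded p q w μ := by
  obtain ⟨M, hM⟩ := hsup
  obtain ⟨r, hr, C, hC, hμ⟩ := hdyadic
  obtain ⟨K, hK, hardy⟩ := exists_tsum_lintegral_mul_exp_rpow_le hp hα hr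
  have hp0 : 0 < p := by linarith
  have hp1 : 0 < p - 1 := by linarith
  have hq0 : 0 < q := by linarith
  have hM0 : 0 < M := by
    have := hwpos 1 one_pos
    exact lt_of_lt_of_le (by positivity) (hM 1 one_pos)
  set γ := (p - 1 - α) / p with hγ
  have hexp : (q / (p / (p - 1))) * (1 - α / (p - 1)) = γ * q := by
    rw [hγ]; field_simp
  set D := C * 2 ^ (γ * q)
  have hD : 0 < D := by positivity
  refine ⟨D ^ (1 / q) * (K * M) ^ (1 / p), by positivity, fun f hf ↦ ?_⟩
  set F : ℤ → ℝ≥0∞ := fun n ↦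
    ∫⁻ t in Ioi (0 : ℝ), ‖f t‖ₑ * ENNReal.ofReal (Real.exp (-(t * (2 ^ n * r))))
  set N := ∫⁻ t in Ioi (0 : ℝ), ‖f t‖ₑ ^ p * ENNReal.ofReal (w t)
  have hweight : ∫⁻ t in Ioi (0 : ℝ), ‖f t‖ₑ ^ p * ENNReal.ofReal (t ^ α) ≤
      ENNReal.ofReal M * N := by
    rw [← lintegral_const_mul _ (by fun_prop)]
    refine setLIntegral_mono' measurableSet_Ioi fun t ht ↦ ?_
    rw [mul_left_comm, ← ENNReal.ofReal_mul hM0.le]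
    gcongr
    exact (div_le_iff₀ (hwpos t ht)).1 (hM t ht)
  have hterm (n : ℤ) : F n ^ q * μ (sectorDelta θ (2 ^ (n + 1) * r)) ≤
      ENNReal.ofReal D * (F n * ENNReal.ofReal (((2 : ℝ) ^ n * r) ^ γ)) ^ q := by
    have hx : 0 < (2 : ℝ) ^ n * r := by positivity
    calc _ ≤ F n ^ q * ENNReal.ofReal (C * ((2 : ℝ) ^ (n + 1) * r) ^ (γ * q)) := by
          gcongr
          rw [← hexp]
          exact hμ (n + 1)
      _ = _ := by
          rw [ENNReal.mul_rpow_of_nonneg _ _ hq0.le, ENNReal.ofReal_rpow_of_pos (by positivity),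
            mul_left_comm, ← ENNReal.ofReal_mul hD.le, ← Real.rpow_mul hx.le,
            zpow_add_one₀ two_ne_zero, mul_comm _ (2 : ℝ), mul_assoc 2,
            Real.mul_rpow two_pos.le hx.le, ← mul_assoc C]
  have hmain : ∫⁻ z, ‖laplaceT f z‖ₑ ^ q ∂μ ≤
      ENNReal.ofReal D * (ENNReal.ofReal (K * M) * N) ^ (q / p) := by
    calc _ ≤ ∑' n, F n ^ q * μ (sectorDelta θ (2 ^ (n + 1) * r)) :=
          lintegral_laplaceT_rpow_le hq0.le hr hsupp f
      _ ≤ ∑' n, ENNReal.ofReal D * (F n * ENNReal.ofReal (((2 : ℝ) ^ n * r) ^ γ)) ^ q :=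
          ENNReal.tsum_le_tsum hterm
      _ ≤ ENNReal.ofReal D *
          (∑' n, (F n * ENNReal.ofReal (((2 : ℝ) ^ n * r) ^ γ)) ^ p) ^ (q / p) := by
          rw [ENNReal.tsum_mul_left]
          gcongr
          exact ENNReal.tsum_rpow_le_rpow_tsum _ hp0 hpq
      _ ≤ _ := by
          gcongr
          refine (hardy _ hf.enorm).trans ?_
          rw [ENNReal.ofReal_mul hK.le, mul_assoc]
          gcongr
  calc _ ≤ (ENNReal.ofReal D * (ENNReal.ofReal (K * M) * N) ^ (q / p)) ^ (1 / q) := by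
        gcongr
        exact hmain
    _ = ENNReal.ofReal (D ^ (1 / q) * (K * M) ^ (1 / p)) * N ^ (1 / p) := by
        rw [ENNReal.mul_rpow_of_nonneg _ _ (by positivity), ← ENNReal.rpow_mul,
          show q / p * (1 / q) = 1 / p by field_simp,
          ENNReal.mul_rpow_of_nonneg _ _ (by positivity),
          ENNReal.ofReal_rpow_of_pos hD, ENNReal.ofReal_rpow_of_pos (by positivity), ← mul_assoc,
          ← ENNReal.ofReal_mul (by positivity)]
end

section
/- Let μ := Σ_{n=1}^∞ δ_{n²π²}, a positive Borel measure on ℂ₊ supported on the positive real axis (this measure arises from the one-dimensional heat equation on [0,1] with Neumann boundary control, where λ_n = −n²π² and b_n = 1). Let 1 < p ≤ 2 and α < p − 1. Then the Laplace–Carleson embedding 𝔏 : L^p_{t^α}(0,∞) → L²(ℂ₊, μ) is bounded if and only if p ≥ (4/3)(α + 1). -/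
open MeasureTheory Set Complex Filter ENNReal

lemma rpow_le_mul_exp {a : ℝ} (ha : 0 ≤ a) {s : ℝ} (hs : 0 < s) :
    s ^ a ≤ (a + 1) ^ a * Real.exp s := by
  have h1 : s ≤ (a + 1) * Real.exp (s / (a + 1)) := by
    have := Real.add_one_le_exp (s / (a + 1))
    have h2 : s = (a + 1) * (s / (a + 1)) := by field_simp
    calc s = (a + 1) * (s / (a + 1)) := h2
      _ ≤ _ := by gcongr; linarith
  calc s ^ a ≤ ((a + 1) * Real.exp (s / (a + 1))) ^ a := by gcongr
    _ = (a + 1) ^ a * Real.exp (s / (a + 1) * a) := by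
      rw [Real.mul_rpow (by positivity) (by positivity), ← Real.exp_mul]
    _ ≤ _ := by
      gcongr
      rw [div_mul_eq_mul_div, div_le_iff₀ (by positivity)]
      nlinarith

lemma sum_exp_neg_sq_mul_le {s : ℝ} (hs : 0 < s) (N : ℕ) :
    ∑ n ∈ Finset.range N, Real.exp (-s * ((n : ℝ) + 1) ^ 2) ≤ √(Real.pi / s) / 2 := by
  have hanti : AntitoneOn (fun x : ℝ => Real.exp (-s * x ^ 2)) (Icc 0 (0 + N)) := by
    intro x hx y hy hxy
    have := hx.1
    simp only [neg_mul, Real.exp_le_exp, neg_le_neg_iff]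
    gcongr
  have h := hanti.sum_le_integral
  simp only [zero_add, Nat.cast_add, Nat.cast_one] at h
  refine h.trans ?_
  rw [← integral_gaussian_Ioi s, intervalIntegral.integral_of_le (by positivity)]
  refine setIntegral_mono_set (integrable_exp_neg_mul_sq hs).integrableOn
    (Eventually.of_forall fun _ => by positivity) ?_
  exact (Ioc_subset_Ioi_self).eventuallyLE

lemma tsum_exp_neg_heat_le {γ : ℝ} (hγ : 1 / 4 ≤ γ) :
    ∃ C > 0, ∀ s : ℝ, 0 < s →
      ∑' n : ℕ, ENNReal.ofReal (Real.exp (-(s * (((n : ℝ) + 1) ^ 2 * Real.pi ^ 2)))) ≤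
        ENNReal.ofReal (C * s ^ (-(2 * γ))) := by
  have ha : (0 : ℝ) ≤ 2 * γ - 1 / 2 := by linarith
  refine ⟨(2 * γ - 1 / 2 + 1) ^ (2 * γ - 1 / 2) * (√Real.pi / 2), by positivity, fun s hs => ?_⟩
  refine ENNReal.tsum_le_of_sum_range_le fun N => ?_
  rw [← ENNReal.ofReal_sum_of_nonneg fun _ _ => (Real.exp_pos _).le]
  refine ENNReal.ofReal_le_ofReal ?_
  have hpi : (9 : ℝ) ≤ Real.pi ^ 2 := by nlinarith [Real.pi_gt_three]
  have hterm (n : ℕ) : Real.exp (-(s * (((n : ℝ) + 1) ^ 2 * Real.pi ^ 2))) ≤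
      Real.exp (-s) * Real.exp (-s * ((n : ℝ) + 1) ^ 2) := by
    rw [← Real.exp_add, Real.exp_le_exp]
    have h1 : (1 : ℝ) ≤ ((n : ℝ) + 1) ^ 2 := one_le_pow₀ (by simp)
    have h2 : 1 + ((n : ℝ) + 1) ^ 2 ≤ ((n : ℝ) + 1) ^ 2 * Real.pi ^ 2 := by nlinarith
    nlinarith [mul_le_mul_of_nonneg_left h2 hs.le]
  have hexp : Real.exp (-s) ≤
      (2 * γ - 1 / 2 + 1) ^ (2 * γ - 1 / 2) * s ^ (-(2 * γ - 1 / 2)) := by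
    rw [Real.exp_neg, Real.rpow_neg hs.le, ← div_eq_mul_inv, inv_le_comm₀ (by positivity)
      (by positivity), inv_div, div_le_iff₀' (by positivity)]
    exact rpow_le_mul_exp ha hs
  calc _ ≤ ∑ n ∈ Finset.range N, Real.exp (-s) * Real.exp (-s * ((n : ℝ) + 1) ^ 2) :=
        Finset.sum_le_sum fun n _ => hterm n
    _ ≤ Real.exp (-s) * (√(Real.pi / s) / 2) := by
        rw [← Finset.mul_sum]
        gcongr
        exact sum_exp_neg_sq_mul_le hs N
    _ ≤ ((2 * γ - 1 / 2 + 1) ^ (2 * γ - 1 / 2) * s ^ (-(2 * γ - 1 / 2))) *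
        (√(Real.pi / s) / 2) := by gcongr
    _ = _ := by
        have h : s ^ (-(2 * γ)) = s ^ (-(2 * γ - 1 / 2)) * (√s)⁻¹ := by
          rw [Real.sqrt_eq_rpow, ← Real.rpow_neg hs.le, ← Real.rpow_add hs]
          congr 1; ring
        rw [h, Real.sqrt_div' _ hs.le]
        ring

lemma ENNReal.mul_le_sq_add_sq (a b : ℝ≥0∞) : a * b ≤ a ^ 2 + b ^ 2 := by
  rcases le_total a b with h | h
  · exact (mul_le_mul_left h b).trans (by rw [← sq]; exact le_add_self)
  · exact (mul_le_mul_right h a).trans (by rw [← sq]; exact le_self_add)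

lemma ENNReal.tsum_sq_le_tsum_rpow {ι : Type*} {p : ℝ} (hp : 0 < p) (hp2 : p ≤ 2)
    (b : ι → ℝ≥0∞) : ∑' k, b k ^ 2 ≤ (∑' k, b k ^ p) ^ (2 / p) := by
  set M := ∑' k, b k ^ p with hM
  have hle (k : ι) : b k ≤ M ^ (1 / p) := by
    rw [one_div, ENNReal.le_rpow_inv_iff hp]
    exact ENNReal.le_tsum k
  calc ∑' k, b k ^ 2 ≤ ∑' k, b k ^ p * M ^ ((2 - p) / p) := by
        refine ENNReal.tsum_le_tsum fun k => ?_
        have h2 : b k ^ 2 = b k ^ p * b k ^ (2 - p) := by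
          rw [← ENNReal.rpow_add_of_nonneg _ _ hp.le (by linarith), add_sub_cancel]
          exact (ENNReal.rpow_two _).symm
        rw [h2]
        gcongr
        calc b k ^ (2 - p) ≤ (M ^ (1 / p)) ^ (2 - p) :=
              ENNReal.rpow_le_rpow (hle k) (by linarith)
          _ = M ^ ((2 - p) / p) := by rw [← ENNReal.rpow_mul]; congr 1; ring
    _ = M ^ (2 / p) := by
        rw [ENNReal.tsum_mul_right, ← hM]
        nth_rewrite 1 [← ENNReal.rpow_one M]
        rw [← ENNReal.rpow_add_of_nonneg _ _ zero_le_one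
          (div_nonneg (by linarith) hp.le)]
        congr 1; field_simp; ring

/-- Schur's test for a convolution kernel on `ℤ`. -/
lemma ENNReal.tsum_tsum_mul_mul_le (K b : ℤ → ℝ≥0∞) :
    ∑' k, ∑' j, b k * b j * K (k - j) ≤ 2 * (∑' m, K m) * ∑' k, b k ^ 2 := by
  have hsum (k : ℤ) : ∑' j, K (k - j) = ∑' m, K m := (Equiv.subLeft k).tsum_eq K
  have hsum' (k : ℤ) : ∑' j, K (j - k) = ∑' m, K m := (Equiv.subRight k).tsum_eq K
  calc _ ≤ ∑' k, ∑' j, (b k ^ 2 * K (k - j) + b j ^ 2 * K (k - j)) := by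
        refine ENNReal.tsum_le_tsum fun k => ENNReal.tsum_le_tsum fun j => ?_
        rw [← add_mul]
        gcongr
        exact ENNReal.mul_le_sq_add_sq _ _
    _ = ∑' k, ∑' j, b k ^ 2 * K (k - j) + ∑' j, ∑' k, b j ^ 2 * K (k - j) := by
        rw [ENNReal.tsum_comm (f := fun j k => b j ^ 2 * K (k - j)), ← ENNReal.tsum_add]
        exact tsum_congr fun k => ENNReal.tsum_add
    _ = _ := by
        simp only [ENNReal.tsum_mul_left, hsum, hsum', ENNReal.tsum_mul_right]
        ring

/-- The `k`-th dyadic block of `(0,∞)`. -/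
def dyadicIco (k : ℤ) : Set ℝ := Ico ((2 : ℝ) ^ k) (2 ^ (k + 1))

lemma measurableSet_dyadicIco (k : ℤ) : MeasurableSet (dyadicIco k) := measurableSet_Ico

lemma iUnion_dyadicIco : ⋃ k, dyadicIco k = Ioi 0 := by
  ext t
  simp only [mem_iUnion, mem_Ioi]
  exact ⟨fun ⟨k, hk⟩ => (zpow_pos two_pos k).trans_le hk.1,
    fun ht => exists_mem_Ico_zpow ht one_lt_two⟩

lemma lintegral_Ioi_eq_tsum_dyadicIco (g : ℝ → ℝ≥0∞) :
    ∫⁻ t in Ioi (0 : ℝ), g t = ∑' k, ∫⁻ t in dyadicIco k, g t := by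
  rw [← iUnion_dyadicIco]
  exact lintegral_iUnion measurableSet_dyadicIco
    (zpow_right_mono₀ (one_le_two (α := ℝ))).pairwise_disjoint_on_Ico_succ g

lemma two_rpow_le_mul_rpow {α : ℝ} {k : ℤ} {t : ℝ} (ht : t ∈ dyadicIco k) :
    (2 : ℝ) ^ ((k : ℝ) * α) ≤ 2 ^ |α| * t ^ α := by
  obtain ⟨h1, h2⟩ := ht
  rw [← Real.rpow_intCast] at h1 h2
  push_cast at h2
  have ht0 : 0 < t := (Real.rpow_pos_of_pos two_pos _).trans_le h1
  rcases le_total 0 α with h | h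
  · rw [Real.rpow_mul two_pos.le]
    calc ((2 : ℝ) ^ (k : ℝ)) ^ α ≤ t ^ α := by gcongr
      _ ≤ _ := le_mul_of_one_le_left (by positivity)
        (Real.one_le_rpow one_le_two (abs_nonneg _))
  · calc (2 : ℝ) ^ ((k : ℝ) * α) = 2 ^ |α| * ((2 : ℝ) ^ ((k : ℝ) + 1)) ^ α := by
          rw [← Real.rpow_mul two_pos.le, ← Real.rpow_add two_pos, abs_of_nonpos h]
          congr 1; ring
      _ ≤ _ := by
          gcongr ?_ * ?_
          exact Real.rpow_le_rpow_of_nonpos ht0 h2.le h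

lemma lintegral_dyadicIco_le {p : ℝ} (hp : 1 < p) (α : ℝ) (k : ℤ) {g : ℝ → ℝ≥0∞}
    (hg : Measurable g) :
    ∫⁻ t in dyadicIco k, g t ≤
      ENNReal.ofReal (2 ^ (|α| / p) * 2 ^ ((k : ℝ) * (1 - (1 + α) / p))) *
        (∫⁻ t in dyadicIco k, g t ^ p * ENNReal.ofReal (t ^ α)) ^ (1 / p) := by
  have hp0 : 0 < p := one_pos.trans hp
  have hvol : volume (dyadicIco k) = ENNReal.ofReal (2 ^ (k : ℝ)) := by
    rw [dyadicIco, Real.volume_Ico, Real.rpow_intCast, zpow_add₀ two_ne_zero]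
    congr 1; ring
  have hconj := Real.HolderConjugate.conjExponent hp
  have hq : 1 / Real.conjExponent p = 1 - 1 / p := by
    rw [one_div, one_div, hconj.one_sub_inv]
  have h1 : ∫⁻ t in dyadicIco k, g t ≤
      (∫⁻ t in dyadicIco k, g t ^ p) ^ (1 / p) *
        ENNReal.ofReal (2 ^ (k : ℝ)) ^ (1 - 1 / p) := by
    have := ENNReal.lintegral_mul_le_Lp_mul_Lq (volume.restrict (dyadicIco k)) hconj
      hg.aemeasurable (aemeasurable_const (b := (1 : ℝ≥0∞)))
    rw [hq] at this
    simpa [hvol] using this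
  have h2 : ∫⁻ t in dyadicIco k, g t ^ p ≤
      ENNReal.ofReal (2 ^ |α| * 2 ^ (-((k : ℝ) * α))) *
        ∫⁻ t in dyadicIco k, g t ^ p * ENNReal.ofReal (t ^ α) := by
    rw [← lintegral_const_mul' _ _ ENNReal.ofReal_ne_top]
    refine setLIntegral_mono' (measurableSet_dyadicIco k) fun t ht => ?_
    have ht0 : 0 < t := (zpow_pos two_pos k).trans_le ht.1
    rw [mul_left_comm, ← ENNReal.ofReal_mul (by positivity)]
    refine le_mul_of_one_le_right' ?_
    rw [ENNReal.one_le_ofReal, Real.rpow_neg two_pos.le, mul_right_comm, ← div_eq_mul_inv,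
      one_le_div (by positivity)]
    exact two_rpow_le_mul_rpow ht
  refine h1.trans ((mul_le_mul_left (ENNReal.rpow_le_rpow h2 (by positivity)) _).trans_eq ?_)
  rw [ENNReal.mul_rpow_of_nonneg _ _ (by positivity), mul_right_comm]
  congr 1
  have hp1 : 1 / p ≤ 1 := (div_le_one hp0).2 hp.le
  rw [ENNReal.ofReal_rpow_of_nonneg (by positivity) (by positivity),
    ENNReal.ofReal_rpow_of_nonneg (by positivity) (by linarith),
    ← ENNReal.ofReal_mul (by positivity)]
  congr 1
  rw [← Real.rpow_add two_pos, ← Real.rpow_mul two_pos.le, ← Real.rpow_mul two_pos.le,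
    ← Real.rpow_add two_pos, ← Real.rpow_add two_pos]
  congr 1; field_simp; ring

lemma enorm_laplaceT_ofReal_le (f : ℝ → ℂ) {x : ℝ} (hx : 0 ≤ x) :
    ‖laplaceT f x‖ₑ ≤
      ∑' k : ℤ, (∫⁻ t in dyadicIco k, ‖f t‖ₑ) * ENNReal.ofReal (Real.exp (-((2 : ℝ) ^ k * x))) := by
  refine (enorm_integral_le_lintegral_enorm _).trans ?_
  rw [lintegral_Ioi_eq_tsum_dyadicIco]
  refine ENNReal.tsum_le_tsum fun k => ?_
  rw [← lintegral_mul_const' _ _ ENNReal.ofReal_ne_top]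
  refine setLIntegral_mono' (measurableSet_dyadicIco k) fun t ht => ?_
  rw [enorm_mul]
  gcongr
  rw [← ofReal_norm, Complex.norm_exp]
  refine ENNReal.ofReal_le_ofReal (Real.exp_le_exp.2 ?_)
  have : (-(t : ℂ) * x).re = -(t * x) := by simp
  rw [this, neg_le_neg_iff]
  exact mul_le_mul_of_nonneg_right ht.1 hx

lemma tsum_two_rpow_neg_abs_ne_top {γ : ℝ} (hγ : 0 < γ) :
    ∑' m : ℤ, ENNReal.ofReal (2 ^ (-(γ * |(m : ℝ)|))) ≠ ∞ := by
  refine Summable.tsum_ofReal_ne_top ?_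
  have hgeo : Summable fun n : ℕ => ((2 : ℝ) ^ (-γ)) ^ n :=
    summable_geometric_of_lt_one (by positivity)
      (Real.rpow_lt_one_of_one_lt_of_neg one_lt_two (by linarith))
  refine Summable.of_nat_of_neg (hgeo.congr fun n => ?_) (hgeo.congr fun n => ?_) <;>
  · rw [← Real.rpow_natCast, ← Real.rpow_mul two_pos.le]
    simp

lemma two_rpow_mul_add_rpow_le {γ : ℝ} (hγ : 0 ≤ γ) (k j : ℤ) :
    (2 : ℝ) ^ ((k : ℝ) * γ) * 2 ^ ((j : ℝ) * γ) * ((2 : ℝ) ^ k + 2 ^ j) ^ (-(2 * γ)) ≤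
      2 ^ (-(γ * |((k - j : ℤ) : ℝ)|)) := by
  wlog h : j ≤ k generalizing j k
  · have := this j k (by omega)
    rw [mul_comm ((2 : ℝ) ^ ((k : ℝ) * γ)), add_comm ((2 : ℝ) ^ k)]
    refine this.trans_eq ?_
    push_cast
    rw [abs_sub_comm]
  have h' : (j : ℝ) ≤ k := by exact_mod_cast h
  have h1 : ((2 : ℝ) ^ k + 2 ^ j) ^ (-(2 * γ)) ≤ ((2 : ℝ) ^ (k : ℝ)) ^ (-(2 * γ)) := by
    refine Real.rpow_le_rpow_of_nonpos (by positivity) ?_ (by linarith)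
    rw [Real.rpow_intCast]
    linarith [zpow_pos (two_pos (α := ℝ)) j]
  refine (mul_le_mul_of_nonneg_left h1 (by positivity)).trans_eq ?_
  push_cast
  rw [abs_of_nonneg (by linarith), ← Real.rpow_mul two_pos.le, ← Real.rpow_add two_pos,
    ← Real.rpow_add two_pos]
  congr 1; ring

lemma lintegral_sum_dirac_heat (g : ℂ → ℝ≥0∞) :
    ∫⁻ z, g z ∂(Measure.sum fun n : ℕ =>
      Measure.dirac ((((n : ℝ) + 1) ^ 2 * Real.pi ^ 2 : ℝ) : ℂ)) =
      ∑' n : ℕ, g ((((n : ℝ) + 1) ^ 2 * Real.pi ^ 2 : ℝ) : ℂ) := by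
  rw [lintegral_sum_measure]
  exact tsum_congr fun n => lintegral_dirac _ _

lemma tsum_sq_enorm_laplaceT_le {C γ : ℝ}
    (hC : ∀ s : ℝ, 0 < s →
      ∑' n : ℕ, ENNReal.ofReal (Real.exp (-(s * (((n : ℝ) + 1) ^ 2 * Real.pi ^ 2)))) ≤
        ENNReal.ofReal (C * s ^ (-(2 * γ)))) (f : ℝ → ℂ) :
    ∑' n : ℕ, ‖laplaceT f ((((n : ℝ) + 1) ^ 2 * Real.pi ^ 2 : ℝ) : ℂ)‖ₑ ^ 2 ≤
      ∑' k : ℤ, ∑' j : ℤ, (∫⁻ t in dyadicIco k, ‖f t‖ₑ) * (∫⁻ t in dyadicIco j, ‖f t‖ₑ) *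
        ENNReal.ofReal (C * ((2 : ℝ) ^ k + 2 ^ j) ^ (-(2 * γ))) := by
  set c : ℤ → ℝ≥0∞ := fun k => ∫⁻ t in dyadicIco k, ‖f t‖ₑ
  set e : ℝ → ℕ → ℝ≥0∞ := fun s n =>
    ENNReal.ofReal (Real.exp (-(s * (((n : ℝ) + 1) ^ 2 * Real.pi ^ 2)))) with he
  have hadd (s t : ℝ) (n : ℕ) : e s n * e t n = e (s + t) n := by
    simp only [he]
    rw [← ENNReal.ofReal_mul (Real.exp_pos _).le, ← Real.exp_add]
    congr 2; ring
  calc _ ≤ ∑' n : ℕ, (∑' k : ℤ, c k * e (2 ^ k) n) ^ 2 := by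
        refine ENNReal.tsum_le_tsum fun n => ?_
        gcongr
        exact enorm_laplaceT_ofReal_le f (by positivity)
    _ = ∑' n : ℕ, ∑' k : ℤ, ∑' j : ℤ, c k * c j * e (2 ^ k + 2 ^ j) n := by
        refine tsum_congr fun n => ?_
        rw [sq, ← ENNReal.tsum_mul_right]
        refine tsum_congr fun k => ?_
        rw [← ENNReal.tsum_mul_left]
        refine tsum_congr fun j => ?_
        rw [mul_mul_mul_comm, hadd]
    _ = ∑' k : ℤ, ∑' j : ℤ, c k * c j * ∑' n : ℕ, e (2 ^ k + 2 ^ j) n := by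
        rw [ENNReal.tsum_comm]
        refine tsum_congr fun k => ?_
        rw [ENNReal.tsum_comm]
        exact tsum_congr fun j => ENNReal.tsum_mul_left
    _ ≤ _ := by
        refine ENNReal.tsum_le_tsum fun k => ENNReal.tsum_le_tsum fun j => ?_
        gcongr
        exact hC _ (by positivity)

lemma lcBounded_heat {p α : ℝ} (hp1 : 1 < p) (hp2 : p ≤ 2) (h : 4 / 3 * (α + 1) ≤ p) :
    lcBounded p 2 (fun t => t ^ α) (Measure.sum fun n : ℕ =>
      Measure.dirac ((((n : ℝ) + 1) ^ 2 * Real.pi ^ 2 : ℝ) : ℂ)) := by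
  have hp0 : 0 < p := one_pos.trans hp1
  set γ := 1 - (1 + α) / p
  have hγ : 1 / 4 ≤ γ := by
    have : (1 + α) / p ≤ 3 / 4 := by rw [div_le_iff₀ hp0]; linarith
    linarith
  obtain ⟨C, hC0, hC⟩ := tsum_exp_neg_heat_le hγ
  set D : ℝ := 2 ^ (|α| / p)
  have hD0 : 0 < D := by positivity
  set K : ℤ → ℝ≥0∞ := fun m => ENNReal.ofReal (2 ^ (-(γ * |(m : ℝ)|)))
  have hK : ∑' m, K m ≠ ∞ := tsum_two_rpow_neg_abs_ne_top (by linarith)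
  set S : ℝ := D ^ 2 * C * (2 * (∑' m, K m).toReal) with hS
  refine ⟨√S + 1, by positivity, fun f hf => ?_⟩
  set b : ℤ → ℝ≥0∞ := fun k =>
    (∫⁻ t in dyadicIco k, ‖f t‖ₑ ^ p * ENNReal.ofReal (t ^ α)) ^ (1 / p) with hb
  have hbsum : ∑' k, b k ^ p = ∫⁻ t in Ioi (0 : ℝ), ‖f t‖ₑ ^ p * ENNReal.ofReal (t ^ α) := by
    rw [lintegral_Ioi_eq_tsum_dyadicIco]
    refine tsum_congr fun k => ?_
    rw [hb, ← ENNReal.rpow_mul, one_div_mul_cancel hp0.ne', ENNReal.rpow_one]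
  have hterm (k j : ℤ) : (∫⁻ t in dyadicIco k, ‖f t‖ₑ) * (∫⁻ t in dyadicIco j, ‖f t‖ₑ) *
      ENNReal.ofReal (C * ((2 : ℝ) ^ k + 2 ^ j) ^ (-(2 * γ))) ≤
        ENNReal.ofReal (D ^ 2 * C) * (b k * b j * K (k - j)) := by
    calc _ ≤ (ENNReal.ofReal (D * 2 ^ ((k : ℝ) * γ)) * b k) *
          (ENNReal.ofReal (D * 2 ^ ((j : ℝ) * γ)) * b j) *
          ENNReal.ofReal (C * ((2 : ℝ) ^ k + 2 ^ j) ^ (-(2 * γ))) := by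
          gcongr
          · exact lintegral_dyadicIco_le hp1 α k hf.enorm
          · exact lintegral_dyadicIco_le hp1 α j hf.enorm
      _ = ENNReal.ofReal (D * 2 ^ ((k : ℝ) * γ) * (D * 2 ^ ((j : ℝ) * γ)) *
            (C * ((2 : ℝ) ^ k + 2 ^ j) ^ (-(2 * γ)))) * (b k * b j) := by
          rw [ENNReal.ofReal_mul (p := D * 2 ^ ((k : ℝ) * γ) * (D * 2 ^ ((j : ℝ) * γ)))
            (by positivity), ENNReal.ofReal_mul (p := D * 2 ^ ((k : ℝ) * γ)) (by positivity)]
          ring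
      _ ≤ ENNReal.ofReal (D ^ 2 * C * 2 ^ (-(γ * |((k - j : ℤ) : ℝ)|))) * (b k * b j) := by
          refine mul_le_mul_left (ENNReal.ofReal_le_ofReal ?_) _
          calc _ = D ^ 2 * C * ((2 : ℝ) ^ ((k : ℝ) * γ) * 2 ^ ((j : ℝ) * γ) *
                ((2 : ℝ) ^ k + 2 ^ j) ^ (-(2 * γ))) := by ring
            _ ≤ _ := by
              gcongr
              exact two_rpow_mul_add_rpow_le (by linarith) k j
      _ = _ := by
          rw [ENNReal.ofReal_mul (p := D ^ 2 * C) (by positivity)]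
          ring
  have hmain : ∑' n : ℕ, ‖laplaceT f ((((n : ℝ) + 1) ^ 2 * Real.pi ^ 2 : ℝ) : ℂ)‖ₑ ^ 2 ≤
      ENNReal.ofReal S * (∑' k, b k ^ p) ^ (2 / p) := by
    calc _ ≤ ENNReal.ofReal (D ^ 2 * C) * ∑' k, ∑' j, b k * b j * K (k - j) := by
          refine (tsum_sq_enorm_laplaceT_le hC f).trans ?_
          simp only [← ENNReal.tsum_mul_left]
          exact ENNReal.tsum_le_tsum fun k => ENNReal.tsum_le_tsum fun j => hterm k j
      _ ≤ ENNReal.ofReal (D ^ 2 * C) * (2 * (∑' m, K m) * (∑' k, b k ^ p) ^ (2 / p)) := by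
          gcongr
          refine (ENNReal.tsum_tsum_mul_mul_le K b).trans ?_
          gcongr
          exact ENNReal.tsum_sq_le_tsum_rpow hp0 hp2 b
      _ = _ := by
          rw [hS, ENNReal.ofReal_mul (p := D ^ 2 * C) (by positivity), ENNReal.ofReal_mul two_pos.le,
            ENNReal.ofReal_toReal hK]
          simp only [ENNReal.ofReal_ofNat]
          ring
  simp only [lintegral_sum_dirac_heat, lpwNorm, ENNReal.rpow_ofNat]
  rw [hbsum] at hmain
  refine (ENNReal.rpow_le_rpow hmain (by norm_num : (0 : ℝ) ≤ 1 / 2)).trans ?_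
  rw [ENNReal.mul_rpow_of_nonneg _ _ (by norm_num), ← ENNReal.rpow_mul,
    ENNReal.ofReal_rpow_of_nonneg (by positivity) (by norm_num), ← Real.sqrt_eq_rpow,
    show 2 / p * (1 / 2) = 1 / p by ring]
  gcongr
  · linarith
  · exact le_rfl

lemma laplaceT_exp_neg {s x : ℝ} (h : 0 < s + x) :
    laplaceT (fun t => (Real.exp (-(s * t)) : ℂ)) x = ((s + x)⁻¹ : ℝ) := by
  have hint : laplaceT (fun t => (Real.exp (-(s * t)) : ℂ)) x =
      ∫ t : ℝ in Ioi 0, Complex.exp (-(s + x : ℝ) * t) := by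
    refine integral_congr_ae (Eventually.of_forall fun t => ?_)
    simp only [Complex.ofReal_exp]
    rw [← Complex.exp_add]
    congr 1
    push_cast
    ring
  rw [hint, integral_exp_mul_complex_Ioi (by rw [Complex.neg_re, Complex.ofReal_re]; linarith),
    neg_div_neg_eq, Complex.ofReal_zero, mul_zero, Complex.exp_zero, one_div, Complex.ofReal_inv]

lemma lpwNorm_exp_neg {p α s : ℝ} (hp : 0 < p) (hα : -1 < α) (hs : 0 < s) :
    lpwNorm p (fun t => t ^ α) (fun t => (Real.exp (-(s * t)) : ℂ)) =
      ENNReal.ofReal (((1 / (p * s)) ^ (α + 1) * Real.Gamma (α + 1)) ^ (1 / p)) := by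
  have hα1 : 0 < α + 1 := by linarith
  have hps : 0 < p * s := by positivity
  have hG : 0 < Real.Gamma (α + 1) := Real.Gamma_pos_of_pos hα1
  have hval := Real.integral_rpow_mul_exp_neg_mul_Ioi hα1 hps
  have hintble : IntegrableOn (fun t : ℝ => t ^ (α + 1 - 1) * Real.exp (-(p * s * t))) (Ioi 0) := by
    by_contra hcon
    rw [integral_undef hcon] at hval
    have : 0 < (1 / (p * s)) ^ (α + 1) * Real.Gamma (α + 1) := by positivity
    exact this.ne hval
  rw [lpwNorm, ← hval, ← ENNReal.ofReal_rpow_of_nonneg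
    (by rw [hval]; positivity) (by positivity), ofReal_integral_eq_lintegral_ofReal hintble]
  · congr 1
    refine setLIntegral_congr_fun measurableSet_Ioi fun t ht => ?_
    rw [← enorm_eq_nnnorm, ← ofReal_norm, Complex.norm_real, Real.norm_of_nonneg (Real.exp_pos _).le,
      ENNReal.ofReal_rpow_of_nonneg (Real.exp_pos _).le hp.le, ← Real.exp_mul,
      ← ENNReal.ofReal_mul (Real.exp_pos _).le, mul_comm, add_sub_cancel_right]
    congr 3
    ring
  · refine (ae_restrict_iff' measurableSet_Ioi).2 (Eventually.of_forall fun t ht => ?_)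
    have : (0 : ℝ) < t := ht
    simp only [Pi.zero_apply]
    positivity

lemma exists_natCast_rpow_le_of_lcBounded_heat {p α : ℝ} (hp : 0 < p) (hα : -1 < α)
    (h : lcBounded p 2 (fun t => t ^ α) (Measure.sum fun n : ℕ =>
      Measure.dirac ((((n : ℝ) + 1) ^ 2 * Real.pi ^ 2 : ℝ) : ℂ))) :
    ∃ C : ℝ, ∀ N : ℕ, 0 < N → (N : ℝ) ^ (4 * ((α + 1) / p) - 3) ≤ C := by
  obtain ⟨C, hC, hb⟩ := h
  have hα1 : 0 < α + 1 := by linarith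
  have hG : 0 < Real.Gamma (α + 1) := Real.Gamma_pos_of_pos hα1
  set A : ℝ := ((1 / (p * Real.pi ^ 2)) ^ (α + 1) * Real.Gamma (α + 1)) ^ (1 / p)
  refine ⟨(C * A) ^ 2 * (4 * Real.pi ^ 4), fun N hN => ?_⟩
  have hN' : (0 : ℝ) < N := by exact_mod_cast hN
  set s : ℝ := (N : ℝ) ^ 2 * Real.pi ^ 2 with hs
  have hs0 : 0 < s := by positivity
  have hbound := hb (fun t => (Real.exp (-(s * t)) : ℂ)) (by fun_prop)
  simp only [lintegral_sum_dirac_heat, ENNReal.rpow_ofNat] at hbound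
  rw [lpwNorm_exp_neg hp hα hs0, ← ENNReal.ofReal_mul hC.le, one_div (2 : ℝ),
    ENNReal.rpow_inv_le_iff two_pos, ENNReal.rpow_ofNat] at hbound
  have hlow : ENNReal.ofReal (N * ((2 * s)⁻¹) ^ 2) ≤
      ∑' n : ℕ, ‖laplaceT (fun t => (Real.exp (-(s * t)) : ℂ))
        ((((n : ℝ) + 1) ^ 2 * Real.pi ^ 2 : ℝ) : ℂ)‖ₑ ^ 2 := by
    refine le_trans ?_ (ENNReal.sum_le_tsum (Finset.range N))
    calc ENNReal.ofReal (N * ((2 * s)⁻¹) ^ 2) =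
          ∑ n ∈ Finset.range N, ENNReal.ofReal ((2 * s)⁻¹) ^ 2 := by
          rw [Finset.sum_const, Finset.card_range, nsmul_eq_mul, ENNReal.ofReal_mul hN'.le,
            ENNReal.ofReal_natCast, ENNReal.ofReal_pow (by positivity)]
      _ ≤ _ := by
          refine Finset.sum_le_sum fun n hn => ?_
          have hn' : (n : ℝ) + 1 ≤ N := by exact_mod_cast Finset.mem_range.1 hn
          have hle : ((n : ℝ) + 1) ^ 2 * Real.pi ^ 2 ≤ s := by rw [hs]; gcongr
          rw [laplaceT_exp_neg (by positivity), ← ofReal_norm, Complex.norm_real,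
            Real.norm_of_nonneg (by positivity)]
          gcongr
          linarith
  have hfin : N * ((2 * s)⁻¹) ^ 2 ≤
      (C * ((1 / (p * s)) ^ (α + 1) * Real.Gamma (α + 1)) ^ (1 / p)) ^ 2 := by
    rw [← ENNReal.ofReal_le_ofReal_iff (by positivity), ENNReal.ofReal_pow (by positivity)]
    exact hlow.trans hbound
  have hscale : ((1 / (p * s)) ^ (α + 1) * Real.Gamma (α + 1)) ^ (1 / p) =
      A * (N : ℝ) ^ (-(2 * ((α + 1) / p))) := by
    have h1 : 1 / (p * s) = 1 / (p * Real.pi ^ 2) * (N : ℝ) ^ (-2 : ℝ) := by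
      rw [Real.rpow_neg hN'.le, hs, Real.rpow_two]
      field_simp
    rw [h1, Real.mul_rpow (x := 1 / (p * Real.pi ^ 2)) (by positivity) (by positivity), mul_right_comm,
      Real.mul_rpow (by positivity) (by positivity), ← Real.rpow_mul hN'.le,
      ← Real.rpow_mul hN'.le]
    congr 2
    ring
  rw [hscale] at hfin
  have hsplit : (N : ℝ) ^ (4 * ((α + 1) / p) - 3) =
      ((N : ℝ) ^ (2 * ((α + 1) / p))) ^ 2 * (N * ((2 * s)⁻¹) ^ 2) * (4 * Real.pi ^ 4) := by
    rw [Real.rpow_sub hN', show 4 * ((α + 1) / p) = 2 * ((α + 1) / p) * (2 : ℕ) by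
      push_cast; ring, Real.rpow_mul_natCast hN'.le, hs]
    norm_num
    field_simp
    norm_num
  have hcancel : (N : ℝ) ^ (2 * ((α + 1) / p)) * (N : ℝ) ^ (-(2 * ((α + 1) / p))) = 1 := by
    rw [← Real.rpow_add hN', add_neg_cancel, Real.rpow_zero]
  rw [hsplit]
  gcongr
  calc _ ≤ ((N : ℝ) ^ (2 * ((α + 1) / p))) ^ 2 *
        (C * (A * (N : ℝ) ^ (-(2 * ((α + 1) / p))))) ^ 2 := by gcongr
    _ = (C * A) ^ 2 * ((N : ℝ) ^ (2 * ((α + 1) / p)) *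
        (N : ℝ) ^ (-(2 * ((α + 1) / p)))) ^ 2 := by ring
    _ = _ := by rw [hcancel]; ring

lemma le_of_lcBounded_heat {p α : ℝ} (hp : 0 < p)
    (h : lcBounded p 2 (fun t => t ^ α) (Measure.sum fun n : ℕ =>
      Measure.dirac ((((n : ℝ) + 1) ^ 2 * Real.pi ^ 2 : ℝ) : ℂ))) :
    4 / 3 * (α + 1) ≤ p := by
  by_contra! hlt
  obtain ⟨C, hC⟩ := exists_natCast_rpow_le_of_lcBounded_heat hp (by linarith) h
  have hexp : 0 < 4 * ((α + 1) / p) - 3 := by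
    have : 3 / 4 < (α + 1) / p := by rw [lt_div_iff₀ hp]; linarith
    linarith
  obtain ⟨N, hN, hN0⟩ := ((((tendsto_rpow_atTop hexp).comp
    tendsto_natCast_atTop_atTop).eventually_gt_atTop C).and (eventually_gt_atTop 0)).exists
  exact (hC N hN0).not_gt hN

/-- for the heat equation measure `μ = Σ_{n≥1} δ_{n²π²}`,
`1 < p ≤ 2` and `α < p-1`, the Laplace–Carleson embedding
`𝔏 : L^p_{t^α}(0,∞) → L²(ℂ₊,μ)` is bounded iff `p ≥ (4/3)(α+1)`. -/
theorem heat_equation_weighted_admissibility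
    (p α : ℝ) (hp1 : 1 < p) (hp2 : p ≤ 2) (hα : α < p - 1)
    (μ : Measure ℂ)
    (hμ : μ = Measure.sum fun n : ℕ =>
      Measure.dirac ((((n : ℝ) + 1) ^ 2 * Real.pi ^ 2 : ℝ) : ℂ)) :
    lcBounded p 2 (fun t => t ^ α) μ ↔ (4 / 3 : ℝ) * (α + 1) ≤ p := by
  subst hμ
  exact ⟨le_of_lcBounded_heat (one_pos.trans hp1), lcBounded_heat hp1 hp2⟩
end
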